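/- Lookback option with knock-in feature: Let 𝔓 = Ω and assume μ₁,…,μ_n satisfy Assumption A with M⁻_μ ≠ ∅. For the payoff G(s₁,…,s_n) = (max_{0≤i≤n} s_i − K)⁺ · 1{min_{0≤i≤n} s_i ≤ B} (with s₀ included in the max and min), the recursively defined functions of the duality-gap theorem are β_i(s₁,…,s_i) = (n − 1 − i) + 1{min_{0≤j≤i} s_j ≤ B} for i = 0,…,n−1, and the put-based superhedging price satisfies V^{(p)}_μ(G) = sup_{ℙ ∈ M⁻_μ} E_ℙ[ G(S) − β₀(S₁ − s₀) − Σ_{i=1}^{n−1} β_i(S₁,…,S_i)(S_{i+1} − S_i) ]. -/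

import Mathlib

open MeasureTheory Set Filter Topology
open scoped ENNReal NNReal Classical

noncomputable section

namespace RobustFin

/-- Canonical path space: the values `S₀, S₁, …, S_n` of the asset. -/
abbrev Path (n : ℕ) := Fin (n + 1) → ℝ

/-- Paths starting at `s₀` with nonnegative coordinates: the canonical space `Ω`. -/
def Omega (n : ℕ) (s₀ : ℝ) : Set (Path n) := {ω | ω 0 = s₀ ∧ ∀ i, 0 ≤ ω i}

/-- The first `j` coordinates `S₁, …, S_j` of a path. -/
def restr {n : ℕ} (j : Fin n) (ω : Path n) : Fin j → ℝ :=
  fun i => ω ⟨(i : ℕ) + 1, by have h1 := i.isLt; have h2 := j.isLt; omega⟩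

/-- The coordinates `S₁, …, S_n` of a path. -/
def tailCoords {n : ℕ} (ω : Path n) : Fin n → ℝ := fun i => ω i.succ

/-- A dynamic trading strategy: bounded measurable positions `Δ_j(S₁,…,S_j)`. -/
structure Dyn (n : ℕ) where
  pos : (j : Fin n) → (Fin j → ℝ) → ℝ
  meas : ∀ j, Measurable (pos j)
  bdd : ∀ j, ∃ C, ∀ x, |pos j x| ≤ C

/-- No short selling: all dynamic positions are nonnegative. -/
def Dyn.Nonneg {n : ℕ} (D : Dyn n) : Prop := ∀ j x, 0 ≤ D.pos j x

/-- Gains from dynamic trading: `Σ_j Δ_j(S₁,…,S_j)(S_{j+1} − S_j)`. -/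
def Dyn.gains {n : ℕ} (D : Dyn n) (ω : Path n) : ℝ :=
  ∑ j : Fin n, D.pos j (restr j ω) * (ω j.succ - ω j.castSucc)

/-- A static option portfolio: a constant (cash) position plus a finite linear
combination of options with maturity indices `idx` and nonnegative strikes. -/
structure Static (n : ℕ) where
  const : ℝ
  m : ℕ
  coeff : Fin m → ℝ
  idx : Fin m → Fin n
  strike : Fin m → ℝ
  strike_nonneg : ∀ k, 0 ≤ strike k

/-- Payoff of the portfolio when the options are call options. -/
def Static.callPayoff {n : ℕ} (X : Static n) (ω : Path n) : ℝ :=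
  X.const + ∑ k, X.coeff k * max (ω (X.idx k).succ - X.strike k) 0

/-- Payoff of the portfolio when the options are put options. -/
def Static.putPayoff {n : ℕ} (X : Static n) (ω : Path n) : ℝ :=
  X.const + ∑ k, X.coeff k * max (X.strike k - ω (X.idx k).succ) 0

/-- Price of a static portfolio, given the unit option prices `c i K`;
this is the (unique) linear pricing functional determined by the prices. -/
def Static.price {n : ℕ} (X : Static n) (c : Fin n → ℝ → ℝ) : ℝ :=
  X.const + ∑ k, X.coeff k * c (X.idx k) (X.strike k)

/-- Expectation of a real payoff, valued in `EReal`, with the convention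
`∞ − ∞ = −∞` (in `EReal`, `⊤ - ⊤ = ⊥`). -/
def eexp {n : ℕ} (P : Measure (Path n)) (f : Path n → ℝ) : EReal :=
  ((∫⁻ ω, ENNReal.ofReal (f ω) ∂P : ℝ≥0∞) : EReal) -
    ((∫⁻ ω, ENNReal.ofReal (-(f ω)) ∂P : ℝ≥0∞) : EReal)

/-- The positive part of an extended real number, in `ℝ≥0∞`. -/
def posE (x : EReal) : ℝ≥0∞ := if x = ⊤ then ⊤ else ENNReal.ofReal x.toReal

/-- Expectation of an `EReal`-valued payoff, with the convention `∞ − ∞ = −∞`. -/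
def eexpE {n : ℕ} (P : Measure (Path n)) (f : Path n → EReal) : EReal :=
  ((∫⁻ ω, posE (f ω) ∂P : ℝ≥0∞) : EReal) - ((∫⁻ ω, posE (-(f ω)) ∂P : ℝ≥0∞) : EReal)

/-- A market calibrated model for the market with static payoffs `pay` (calls or puts),
prices `c` and prediction set `P`. -/
def Calibrated {n : ℕ} (pay : Static n → Path n → ℝ) (c : Fin n → ℝ → ℝ)
    (P : Set (Path n)) (Q : Measure (Path n)) : Prop :=
  IsProbabilityMeasure Q ∧ Q P = 1 ∧
    ∀ (X : Static n) (D : Dyn n), D.Nonneg →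
      eexp Q (fun ω => pay X ω + D.gains ω) ≤ (X.price c : EReal)

/-- A weak free lunch with vanishing risk. -/
def WFLVR {n : ℕ} (pay : Static n → Path n → ℝ) (c : Fin n → ℝ → ℝ)
    (P : Set (Path n)) : Prop :=
  ∃ (Xs : ℕ → Static n) (Ds : ℕ → Dyn n) (X : Static n) (D : Dyn n) (L : ℝ),
    (∀ k, (Ds k).Nonneg) ∧ D.Nonneg ∧
    (∀ ω ∈ P, Tendsto (fun k => pay (Xs k) ω + (Ds k).gains ω) atTop (nhds 0)) ∧
    (∀ k, ∀ ω ∈ P, pay X ω + D.gains ω ≤ pay (Xs k) ω + (Ds k).gains ω) ∧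
    Tendsto (fun k => (Xs k).price c) atTop (nhds L) ∧ L < 0

/-- A robust uniformly strong arbitrage. -/
def RobustArbitrage {n : ℕ} (pay : Static n → Path n → ℝ) (c : Fin n → ℝ → ℝ)
    (P : Set (Path n)) : Prop :=
  ∃ (X : Static n) (D : Dyn n), D.Nonneg ∧ X.price c < 0 ∧
    ∀ ω ∈ P, 0 ≤ pay X ω + D.gains ω

/-- The superhedging price of `G` over semi-static strategies (no short selling). -/
def V {n : ℕ} (pay : Static n → Path n → ℝ) (c : Fin n → ℝ → ℝ)
    (P : Set (Path n)) (G : Path n → EReal) : EReal :=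
  sInf {q : EReal | ∃ (X : Static n) (D : Dyn n), D.Nonneg ∧ q = (X.price c : EReal) ∧
    ∀ ω ∈ P, G ω ≤ ((pay X ω + D.gains ω : ℝ) : EReal)}

/-- The superhedging price of `G` when the dynamic positions may take both signs. -/
def Vsigned {n : ℕ} (pay : Static n → Path n → ℝ) (c : Fin n → ℝ → ℝ)
    (P : Set (Path n)) (G : Path n → EReal) : EReal :=
  sInf {q : EReal | ∃ (X : Static n) (D : Dyn n), q = (X.price c : EReal) ∧
    ∀ ω ∈ P, G ω ≤ ((pay X ω + D.gains ω : ℝ) : EReal)}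

/-- `Π_μ`: probability measures on the path space with marginals `δ_{s₀}, μ₁, …, μ_n`. -/
def PiMu {n : ℕ} (s₀ : ℝ) (μ : Fin n → Measure ℝ) : Set (Measure (Path n)) :=
  {π | IsProbabilityMeasure π ∧ π (Omega n s₀) = 1 ∧
       ∀ i : Fin n, π.map (fun ω => ω i.succ) = μ i}

/-- The coordinate process is a supermartingale in its natural filtration:
for every Borel `A ⊆ ℝ₊^j`, `∫ 1_A(S₁,…,S_j)(S_{j+1} − S_j) dπ ≤ 0`. -/
def IsSupermartingaleLaw {n : ℕ} (π : Measure (Path n)) : Prop :=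
  ∀ (j : Fin n) (A : Set (Fin j → ℝ)), MeasurableSet A →
    ∫ ω, Set.indicator A (fun _ => (1 : ℝ)) (restr j ω) * (ω j.succ - ω j.castSucc) ∂π ≤ 0

/-- `M⁻_μ`: calibrated supermartingale measures. -/
def MSet {n : ℕ} (s₀ : ℝ) (μ : Fin n → Measure ℝ) : Set (Measure (Path n)) :=
  {π ∈ PiMu s₀ μ | IsSupermartingaleLaw π}

/-- `M⁻_{μ,𝔓}`: calibrated supermartingale measures giving full mass to `P`. -/
def MSetP {n : ℕ} (s₀ : ℝ) (μ : Fin n → Measure ℝ) (P : Set (Path n)) :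
    Set (Measure (Path n)) :=
  {π ∈ MSet s₀ μ | π P = 1}

/-- Assumption A on the marginals. -/
def AssumptionA {n : ℕ} (s₀ : ℝ) (μ : Fin n → Measure ℝ) : Prop :=
  (∀ i, ∫ x, x ∂(μ i) ≤ s₀) ∧
  (∀ i j : Fin n, i ≤ j → ∫ x, x ∂(μ j) ≤ ∫ x, x ∂(μ i)) ∧
  (∀ φ : ℝ → ℝ, ConcaveOn ℝ Set.univ φ → Monotone φ → (∀ x, 0 ≤ φ x) →
    ∀ i j : Fin n, i ≤ j → ∫ x, φ x ∂(μ j) ≤ ∫ x, φ x ∂(μ i))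

/-- Condition C (i): each `c_i` is nonnegative, convex and nonincreasing on `ℝ₊`. -/
def CondC1 {n : ℕ} (c : Fin n → ℝ → ℝ) : Prop :=
  ∀ i, (∀ x, 0 ≤ x → 0 ≤ c i x) ∧ ConvexOn ℝ (Set.Ici 0) (c i) ∧ AntitoneOn (c i) (Set.Ici 0)

/-- Condition C (ii): `s₀ ≥ c₁(0) ≥ … ≥ c_n(0) ≥ 0` and `c_i'(0+) ≥ −1`
(the latter expressed, for convex `c_i`, through the slopes at `0`). -/
def CondC2 {n : ℕ} (s₀ : ℝ) (c : Fin n → ℝ → ℝ) : Prop :=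
  (∀ i, c i 0 ≤ s₀) ∧ (∀ i j : Fin n, i ≤ j → c j 0 ≤ c i 0) ∧ (∀ i, 0 ≤ c i 0) ∧
    (∀ i, ∀ K : ℝ, 0 < K → c i 0 - K ≤ c i K)

/-- Condition C (iii): `c_i(K) → 0` as `K → ∞`. -/
def CondC3 {n : ℕ} (c : Fin n → ℝ → ℝ) : Prop :=
  ∀ i, Tendsto (c i) atTop (nhds 0)

/-- Condition C (iv): for every `x ≥ 0`, `c_i(0) − c_i(x)` is nonincreasing in `i`. -/
def CondC4 {n : ℕ} (c : Fin n → ℝ → ℝ) : Prop :=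
  ∀ x : ℝ, 0 ≤ x → ∀ i j : Fin n, i ≤ j → c j 0 - c j x ≤ c i 0 - c i x

/-- Condition C. -/
def CondC {n : ℕ} (s₀ : ℝ) (c : Fin n → ℝ → ℝ) : Prop :=
  CondC1 c ∧ CondC2 s₀ c ∧ CondC3 c ∧ CondC4 c

/-- Condition P (i). -/
def CondP1 {n : ℕ} (p : Fin n → ℝ → ℝ) : Prop :=
  ∀ i, (∀ x, 0 ≤ x → 0 ≤ p i x) ∧ ConvexOn ℝ (Set.Ici 0) (p i) ∧ MonotoneOn (p i) (Set.Ici 0)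

/-- Condition P (ii): `s₀ ≥ lim (x − p₁(x)) ≥ … ≥ 0` and `0 ≤ p_i'(0+) ≤ 1`. -/
def CondP2 {n : ℕ} (s₀ : ℝ) (p : Fin n → ℝ → ℝ) : Prop :=
  (∃ L : Fin n → ℝ,
    (∀ i, Tendsto (fun x => x - p i x) atTop (nhds (L i))) ∧
    (∀ i, L i ≤ s₀) ∧ (∀ i j : Fin n, i ≤ j → L j ≤ L i) ∧ (∀ i, 0 ≤ L i)) ∧
  (∃ d : Fin n → ℝ,
    (∀ i, Tendsto (fun K => (p i K - p i 0) / K) (nhdsWithin 0 (Set.Ioi 0)) (nhds (d i))) ∧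
    (∀ i, 0 ≤ d i ∧ d i ≤ 1))

/-- Condition P (iii): `p_i(K) → 0` as `K → 0` (within `ℝ₊`). -/
def CondP3 {n : ℕ} (p : Fin n → ℝ → ℝ) : Prop :=
  ∀ i, Tendsto (p i) (nhdsWithin 0 (Set.Ici 0)) (nhds 0)

/-- Condition P (iv): `p_i(x)` is nondecreasing in `i`. -/
def CondP4 {n : ℕ} (p : Fin n → ℝ → ℝ) : Prop :=
  ∀ x : ℝ, 0 ≤ x → ∀ i j : Fin n, i ≤ j → p i x ≤ p j x

/-- Condition P. -/
def CondP {n : ℕ} (s₀ : ℝ) (p : Fin n → ℝ → ℝ) : Prop :=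
  CondP1 p ∧ CondP2 s₀ p ∧ CondP3 p ∧ CondP4 p

/-- The measures `μ_i` defined from the put prices by `μ_i([0,K]) = p_i'(K)`;
equivalently, `p_i(K) = ∫ (K − x)⁺ μ_i(dx)`. -/
def PutPricesFrom {n : ℕ} (p : Fin n → ℝ → ℝ) (μ : Fin n → Measure ℝ) : Prop :=
  (∀ i, IsProbabilityMeasure (μ i)) ∧ (∀ i, μ i (Set.Iio 0) = 0) ∧
  (∀ i, Integrable (fun x => x) (μ i)) ∧
  (∀ i, ∀ K : ℝ, 0 ≤ K → p i K = ∫ x, max (K - x) 0 ∂(μ i))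

/-- The path `(s₀, s₁, …, s_i, x, s_{i+2}, …, s_n)`. -/
def mkPath {n : ℕ} (s₀ : ℝ) (i : Fin n) (s : Fin i → ℝ) (x : ℝ)
    (t : Fin (n - ((i : ℕ) + 1)) → ℝ) : Path n := fun j =>
  if h0 : (j : ℕ) = 0 then s₀
  else if h1 : (j : ℕ) ≤ (i : ℕ) then
    s ⟨(j : ℕ) - 1, by have := j.isLt; have := i.isLt; omega⟩
  else if h2 : (j : ℕ) = (i : ℕ) + 1 then x
  else t ⟨(j : ℕ) - (i : ℕ) - 2, by have := j.isLt; have := i.isLt; omega⟩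

/-- The family `β_i : ℝ₊^i → ℝ` defined recursively by `β_n = 0` and
`β_i(s₁,…,s_i) = (sup_{s_{i+2},…,s_n} limsup_{x→∞} ((β_{i+1}(s₁,…,s_i,x)
 + G(s₁,…,s_i,x,s_{i+2},…,s_n)/x)·1_𝔓)) ∨ 0`. -/
def IsBetaFamily {n : ℕ} (s₀ : ℝ) (P : Set (Path n)) (G : (Fin n → ℝ) → EReal)
    (β : (i : Fin (n + 1)) → (Fin i → ℝ) → ℝ) : Prop :=
  (∀ s, β (Fin.last n) s = 0) ∧
  ∀ (i : Fin n) (s : Fin i → ℝ), (∀ k, 0 ≤ s k) →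
    (β ⟨(i : ℕ), by have := i.isLt; omega⟩ s : EReal) =
      max 0 (⨆ (t : Fin (n - ((i : ℕ) + 1)) → ℝ) (_ : ∀ k, 0 ≤ t k),
        Filter.limsup (fun x : ℝ =>
          if mkPath s₀ i s x t ∈ P then
            ((β ⟨(i : ℕ) + 1, by have := i.isLt; omega⟩ (Fin.snoc s x) : ℝ) : EReal)
              + G (tailCoords (mkPath s₀ i s x t)) * ((x⁻¹ : ℝ) : EReal)
          else 0) Filter.atTop)

/-- Gains of the dynamic strategy `(β_i)`: `β₀(S₁ − s₀) + Σ_i β_i(S₁,…,S_i)(S_{i+1} − S_i)`. -/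
def gainsOf {n : ℕ} (β : (i : Fin (n + 1)) → (Fin i → ℝ) → ℝ) (ω : Path n) : ℝ :=
  ∑ j : Fin n, β ⟨(j : ℕ), by have := j.isLt; omega⟩ (restr j ω) * (ω j.succ - ω j.castSucc)

/-- The penalty function `λ_𝔓(s₁,…,s_n) = (1 + s₁ + … + s_n)·1{(s₁,…,s_n) ∉ 𝔓}`. -/
def lambdaP {n : ℕ} (P : Set (Path n)) (ω : Path n) : ℝ :=
  if ω ∈ P then 0 else 1 + ∑ i : Fin n, ω i.succ

/-- `min(s₀, s₁, …, s_m)`. -/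
def pmin {m : ℕ} (s₀ : ℝ) (s : Fin m → ℝ) : ℝ :=
  Finset.univ.inf' Finset.univ_nonempty
    (fun j : Fin (m + 1) =>
      if h : (j : ℕ) = 0 then s₀ else s ⟨(j : ℕ) - 1, by have := j.isLt; omega⟩)

/-- `max(s₀, s₁, …, s_m)`. -/
def pmax {m : ℕ} (s₀ : ℝ) (s : Fin m → ℝ) : ℝ :=
  Finset.univ.sup' Finset.univ_nonempty
    (fun j : Fin (m + 1) =>
      if h : (j : ℕ) = 0 then s₀ else s ⟨(j : ℕ) - 1, by have := j.isLt; omega⟩)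


/-- Payoff of a lookback option with knock-in feature (the maximum and minimum
include the initial value `s₀`), with barrier `B ∈ [0,∞]`. -/
def lookbackPayoff {n : ℕ} (s₀ K : ℝ) (B : ℝ≥0∞) (s : Fin n → ℝ) : ℝ :=
  (if ENNReal.ofReal (pmin s₀ s) ≤ B then 1 else 0) * max (pmax s₀ s - K) 0


/-! ### Static portfolios and dynamic strategies: algebra -/

/-- Sum of two static portfolios. -/
def stAdd {n : ℕ} (X Y : Static n) : Static n where
  const := X.const + Y.const
  m := X.m + Y.m
  coeff := Fin.append X.coeff Y.coeff
  idx := Fin.append X.idx Y.idx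
  strike := Fin.append X.strike Y.strike
  strike_nonneg := by
    intro k
    refine Fin.addCases (fun i => ?_) (fun i => ?_) k
    · simpa using X.strike_nonneg i
    · simpa using Y.strike_nonneg i

lemma stAdd_price {n : ℕ} (X Y : Static n) (u : Fin n → ℝ → ℝ) :
    (stAdd X Y).price u = X.price u + Y.price u := by
  change X.const + Y.const + ∑ k : Fin (X.m + Y.m), Fin.append X.coeff Y.coeff k *
    u (Fin.append X.idx Y.idx k) (Fin.append X.strike Y.strike k) = _
  rw [Fin.sum_univ_add]
  simp only [Static.price, Fin.append_left, Fin.append_right]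
  ring

/-- Scalar multiple of a static portfolio. -/
def stSmul {n : ℕ} (a : ℝ) (X : Static n) : Static n where
  const := a * X.const
  m := X.m
  coeff := fun k => a * X.coeff k
  idx := X.idx
  strike := X.strike
  strike_nonneg := X.strike_nonneg

lemma stSmul_price {n : ℕ} (a : ℝ) (X : Static n) (u : Fin n → ℝ → ℝ) :
    (stSmul a X).price u = a * X.price u := by
  simp only [Static.price, stSmul, mul_add, Finset.mul_sum, mul_assoc]
  rfl

/-- A constant portfolio. -/
def stConst (n : ℕ) (a : ℝ) : Static n where
  const := a
  m := 0
  coeff := Fin.elim0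
  idx := fun k => k.elim0
  strike := Fin.elim0
  strike_nonneg := fun k => k.elim0

lemma stConst_price {n : ℕ} (a : ℝ) (u : Fin n → ℝ → ℝ) :
    (stConst n a).price u = a := by
  change a + ∑ k : Fin 0, _ = a
  simp

/-- The portfolio `Σ_i a * option(i, R)`. -/
def stAll (n : ℕ) (a R : ℝ) (hR : 0 ≤ R) : Static n where
  const := 0
  m := n
  coeff := fun _ => a
  idx := fun k => k
  strike := fun _ => R
  strike_nonneg := fun _ => hR

lemma stAll_price {n : ℕ} (a R : ℝ) (hR : 0 ≤ R) (u : Fin n → ℝ → ℝ) :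
    (stAll n a R hR).price u = a * ∑ i, u i R := by
  change 0 + ∑ k : Fin n, a * u k R = _
  simp [Finset.mul_sum]

/-- A single option. -/
def stOne {n : ℕ} (a : ℝ) (i : Fin n) (R : ℝ) (hR : 0 ≤ R) : Static n where
  const := 0
  m := 1
  coeff := fun _ => a
  idx := fun _ => i
  strike := fun _ => R
  strike_nonneg := fun _ => hR

lemma stOne_price {n : ℕ} (a : ℝ) (i : Fin n) (R : ℝ) (hR : 0 ≤ R) (u : Fin n → ℝ → ℝ) :
    (stOne a i R hR).price u = a * u i R := by
  change 0 + ∑ k : Fin 1, a * u i R = _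
  simp

lemma callPayoff_eq {n : ℕ} (X : Static n) (ω : Path n) :
    X.callPayoff ω = X.price (fun i K => max (ω i.succ - K) 0) := rfl

lemma putPayoff_eq {n : ℕ} (X : Static n) (ω : Path n) :
    X.putPayoff ω = X.price (fun i K => max (K - ω i.succ) 0) := rfl

/-- Sum of two dynamic strategies. -/
def dAdd {n : ℕ} (D E : Dyn n) : Dyn n where
  pos := fun j x => D.pos j x + E.pos j x
  meas := fun j => (D.meas j).add (E.meas j)
  bdd := by
    intro j
    obtain ⟨C, hC⟩ := D.bdd j
    obtain ⟨C', hC'⟩ := E.bdd j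
    exact ⟨C + C', fun x => (abs_add_le _ _).trans (add_le_add (hC x) (hC' x))⟩

lemma dAdd_gains {n : ℕ} (D E : Dyn n) (ω : Path n) :
    (dAdd D E).gains ω = D.gains ω + E.gains ω := by
  simp only [Dyn.gains, dAdd, add_mul, Finset.sum_add_distrib]

lemma dAdd_nonneg {n : ℕ} {D E : Dyn n} (hD : D.Nonneg) (hE : E.Nonneg) : (dAdd D E).Nonneg :=
  fun j x => add_nonneg (hD j x) (hE j x)

/-- Scalar multiple of a dynamic strategy. -/
def dSmul {n : ℕ} (a : ℝ) (D : Dyn n) : Dyn n where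
  pos := fun j x => a * D.pos j x
  meas := fun j => (D.meas j).const_mul a
  bdd := by
    intro j
    obtain ⟨C, hC⟩ := D.bdd j
    refine ⟨|a| * C, fun x => ?_⟩
    rw [abs_mul]
    exact mul_le_mul_of_nonneg_left (hC x) (abs_nonneg a)

lemma dSmul_gains {n : ℕ} (a : ℝ) (D : Dyn n) (ω : Path n) :
    (dSmul a D).gains ω = a * D.gains ω := by
  simp only [Dyn.gains, dSmul, Finset.mul_sum, mul_assoc]

lemma dSmul_nonneg {n : ℕ} {a : ℝ} (ha : 0 ≤ a) {D : Dyn n} (hD : D.Nonneg) :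
    (dSmul a D).Nonneg :=
  fun j x => mul_nonneg ha (hD j x)

/-- The zero strategy. -/
def dZero (n : ℕ) : Dyn n where
  pos := fun _ _ => 0
  meas := fun _ => measurable_const
  bdd := fun _ => ⟨0, by simp⟩

lemma dZero_gains {n : ℕ} (ω : Path n) : (dZero n).gains ω = 0 := by
  simp [Dyn.gains, dZero]

lemma dZero_nonneg {n : ℕ} : (dZero n).Nonneg := fun _ _ => le_rfl

/-! ### Supermartingale property and measures -/

/-- The measure `A ↦ ∫ 1_A(T) Y dQ`. -/
def wmap {Ω α : Type*} [MeasurableSpace Ω] [MeasurableSpace α] (Q : Measure Ω) (T : Ω → α)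
    (Y : Ω → ℝ) : Measure α :=
  (Q.withDensity (fun ω => ENNReal.ofReal (Y ω))).map T

section superm
variable {Ω α : Type*} [MeasurableSpace Ω] [MeasurableSpace α] {Q : Measure Ω} {T : Ω → α}
  {Y : Ω → ℝ}

lemma wmap_lintegral (hT : Measurable T) (hY : Measurable Y) {g : α → ℝ≥0∞}
    (hg : Measurable g) :
    ∫⁻ a, g a ∂(wmap Q T Y) = ∫⁻ ω, ENNReal.ofReal (Y ω) * g (T ω) ∂Q := by
  rw [wmap, lintegral_map hg hT,
    lintegral_withDensity_eq_lintegral_mul _ hY.ennreal_ofReal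
    (g := fun ω => g (T ω)) (hg.comp hT)]
  rfl

lemma wmap_finite (hY : Integrable Y Q) : IsFiniteMeasure (wmap Q T Y) := by
  have : IsFiniteMeasure (Q.withDensity (fun ω => ENNReal.ofReal (Y ω))) :=
    isFiniteMeasure_withDensity_ofReal hY.2
  unfold wmap
  infer_instance

lemma integral_eq_wmap (hT : Measurable T) (hY : Measurable Y)
    (hY0 : ∀ᵐ ω ∂Q, 0 ≤ Y ω) {g : α → ℝ} (hg : Measurable g) (hg0 : ∀ a, 0 ≤ g a) :
    ∫ ω, g (T ω) * Y ω ∂Q = (∫⁻ a, ENNReal.ofReal (g a) ∂(wmap Q T Y)).toReal := by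
  rw [wmap_lintegral hT hY hg.ennreal_ofReal, integral_eq_lintegral_of_nonneg_ae]
  · congr 1
    refine lintegral_congr (fun ω => ?_)
    rw [ENNReal.ofReal_mul (hg0 _), mul_comm]
  · filter_upwards [hY0] with ω h using mul_nonneg (hg0 _) h
  · exact ((hg.comp hT).mul hY).aestronglyMeasurable

lemma wmap_lintegral_ne_top (hYi : Integrable Y Q) {g : α → ℝ} {C : ℝ}
    (hgC : ∀ a, |g a| ≤ C) :
    ∫⁻ a, ENNReal.ofReal (g a) ∂(wmap Q T Y) ≠ ⊤ := by
  have := wmap_finite (T := T) hYi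
  refine ((lintegral_mono (fun a => ENNReal.ofReal_le_ofReal ((le_abs_self _).trans (hgC a)))).trans_lt ?_).ne
  rw [lintegral_const]
  exact ENNReal.mul_lt_top ENNReal.ofReal_lt_top (measure_lt_top _ _)

lemma integrable_bdd_mul (hT : Measurable T) (hYi : Integrable Y Q) {g : α → ℝ} {C : ℝ}
    (hg : Measurable g) (hgC : ∀ a, |g a| ≤ C) : Integrable (fun ω => g (T ω) * Y ω) Q :=
  hYi.bdd_mul (hg.comp hT).aestronglyMeasurable (ae_of_all _ (fun ω => hgC (T ω)))

variable {X : Ω → ℝ}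

/-- The inequality for test functions is the inequality of the weighted measures. -/
lemma test_iff (hT : Measurable T) (hY : Measurable Y) (hYi : Integrable Y Q)
    (hY0 : ∀ᵐ ω ∂Q, 0 ≤ Y ω) (hX : Measurable X) (hXi : Integrable X Q)
    (hX0 : ∀ᵐ ω ∂Q, 0 ≤ X ω) {g : α → ℝ} {C : ℝ} (hg : Measurable g) (hg0 : ∀ a, 0 ≤ g a)
    (hgC : ∀ a, |g a| ≤ C) :
    ∫ ω, g (T ω) * (Y ω - X ω) ∂Q ≤ 0 ↔
      ∫⁻ a, ENNReal.ofReal (g a) ∂(wmap Q T Y) ≤ ∫⁻ a, ENNReal.ofReal (g a) ∂(wmap Q T X) := by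
  have h1 : ∫ ω, g (T ω) * (Y ω - X ω) ∂Q =
      ∫ ω, g (T ω) * Y ω ∂Q - ∫ ω, g (T ω) * X ω ∂Q := by
    rw [← integral_sub (integrable_bdd_mul hT hYi hg hgC) (integrable_bdd_mul hT hXi hg hgC)]
    simp only [mul_sub]
  rw [h1, integral_eq_wmap hT hY hY0 hg hg0, integral_eq_wmap hT hX hX0 hg hg0, sub_nonpos,
    ENNReal.toReal_le_toReal (wmap_lintegral_ne_top hYi hgC) (wmap_lintegral_ne_top hXi hgC)]

lemma superm_bdd (hT : Measurable T) (hY : Measurable Y) (hYi : Integrable Y Q)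
    (hY0 : ∀ᵐ ω ∂Q, 0 ≤ Y ω) (hX : Measurable X) (hXi : Integrable X Q)
    (hX0 : ∀ᵐ ω ∂Q, 0 ≤ X ω)
    (h : ∀ A : Set α, MeasurableSet A →
      ∫ ω, Set.indicator A (fun _ => (1 : ℝ)) (T ω) * (Y ω - X ω) ∂Q ≤ 0)
    {g : α → ℝ} {C : ℝ} (hg : Measurable g) (hg0 : ∀ a, 0 ≤ g a) (hgC : ∀ a, |g a| ≤ C) :
    ∫ ω, g (T ω) * (Y ω - X ω) ∂Q ≤ 0 := by
  rw [test_iff hT hY hYi hY0 hX hXi hX0 hg hg0 hgC]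
  refine lintegral_mono' ?_ le_rfl
  refine Measure.le_iff.2 (fun A hA => ?_)
  have h2 := (test_iff hT hY hYi hY0 hX hXi hX0 (C := 1) (measurable_const.indicator hA)
    (fun a => Set.indicator_nonneg (fun _ _ => zero_le_one) a)
    (fun a => by by_cases ha : a ∈ A <;> simp [ha])).1 (h A hA)
  have h3 : ∀ a, ENNReal.ofReal (A.indicator (fun _ => (1 : ℝ)) a) =
      A.indicator (fun _ => (1 : ℝ≥0∞)) a := fun a => by by_cases ha : a ∈ A <;> simp [ha]
  simp only [h3, lintegral_indicator_const hA, one_mul] at h2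
  exact h2

lemma superm_of_cont [PseudoEMetricSpace α] [BorelSpace α]
    (hT : Measurable T) (hY : Measurable Y) (hYi : Integrable Y Q)
    (hY0 : ∀ᵐ ω ∂Q, 0 ≤ Y ω) (hX : Measurable X) (hXi : Integrable X Q)
    (hX0 : ∀ᵐ ω ∂Q, 0 ≤ X ω)
    (h : ∀ g : α → ℝ, Continuous g → (∀ a, 0 ≤ g a) → (∀ a, g a ≤ 1) →
      ∫ ω, g (T ω) * (Y ω - X ω) ∂Q ≤ 0)
    (A : Set α) (hA : MeasurableSet A) :
    ∫ ω, Set.indicator A (fun _ => (1 : ℝ)) (T ω) * (Y ω - X ω) ∂Q ≤ 0 := by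
  have fY := wmap_finite (T := T) hYi
  have fX := wmap_finite (T := T) hXi
  rw [test_iff hT hY hYi hY0 hX hXi hX0 (C := 1) (measurable_const.indicator hA)
    (fun a => Set.indicator_nonneg (fun _ _ => zero_le_one) a)
    (fun a => by by_cases ha : a ∈ A <;> simp [ha])]
  have h3 : ∀ a, ENNReal.ofReal (A.indicator (fun _ => (1 : ℝ)) a) =
      A.indicator (fun _ => (1 : ℝ≥0∞)) a := fun a => by by_cases ha : a ∈ A <;> simp [ha]
  simp only [h3, lintegral_indicator_const hA, one_mul]
  -- closed sets
  have hcl : ∀ F : Set α, IsClosed F → wmap Q T Y F ≤ wmap Q T X F := by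
    intro F hF
    have t1 := tendsto_lintegral_thickenedIndicator_of_isClosed (wmap Q T Y) hF
      (δs := fun k : ℕ => 1 / ((k : ℝ) + 1)) (fun k => by positivity)
      tendsto_one_div_add_atTop_nhds_zero_nat
    have t2 := tendsto_lintegral_thickenedIndicator_of_isClosed (wmap Q T X) hF
      (δs := fun k : ℕ => 1 / ((k : ℝ) + 1)) (fun k => by positivity)
      tendsto_one_div_add_atTop_nhds_zero_nat
    refine le_of_tendsto_of_tendsto' t1 t2 (fun k => ?_)
    set th := thickenedIndicator (δ := 1 / ((k : ℝ) + 1)) (by positivity) F with hth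
    have hc : Continuous (fun a => ((th a : ℝ≥0) : ℝ)) := by fun_prop
    have hle : ∀ a, ((th a : ℝ≥0) : ℝ) ≤ 1 := fun a => by
      exact_mod_cast thickenedIndicator_le_one _ F a
    have := (test_iff hT hY hYi hY0 hX hXi hX0 (C := 1) hc.measurable (fun a => (th a).2)
      (fun a => by exact (abs_of_nonneg (th a).2).trans_le (hle a))).1
      (h _ hc (fun a => (th a).2) hle)
    simpa using this
  rw [hA.measure_eq_iSup_isClosed_of_ne_top (measure_ne_top _ _)]
  refine iSup_le (fun F => iSup_le (fun hFA => iSup_le (fun hF => ?_)))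
  exact (hcl F hF).trans (measure_mono hFA)

end superm


/-! ### Integration under calibrated supermartingale measures -/

lemma measurableSet_Omega (n : ℕ) (s₀ : ℝ) : MeasurableSet (Omega n s₀) := by
  have : Omega n s₀ = {ω : Path n | ω 0 = s₀} ∩ ⋂ i, {ω : Path n | 0 ≤ ω i} := by
    ext ω; simp [Omega]
  rw [this]
  refine (measurableSet_eq_fun (measurable_pi_apply 0) measurable_const).inter
    (MeasurableSet.iInter (fun i => measurableSet_le measurable_const (measurable_pi_apply i)))

lemma measurable_restr {n : ℕ} (j : Fin n) : Measurable (restr j : Path n → _) :=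
  measurable_pi_lambda _ (fun _ => measurable_pi_apply _)

lemma continuous_restr {n : ℕ} (j : Fin n) : Continuous (restr j : Path n → _) :=
  continuous_pi (fun _ => continuous_apply _)

section MS
variable {n : ℕ} {s₀ : ℝ} {μ : Fin n → Measure ℝ} {Q : Measure (Path n)}

lemma ae_Omega (hQ : Q ∈ MSet s₀ μ) : ∀ᵐ ω ∂Q, ω ∈ Omega n s₀ := by
  have := hQ.1.1
  exact (mem_ae_iff_prob_eq_one (measurableSet_Omega n s₀)).2 hQ.1.2.1

lemma integrable_marg (hQ : Q ∈ MSet s₀ μ) (i : Fin n) {f : ℝ → ℝ} (hf : Measurable f)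
    (hi : Integrable f (μ i)) : Integrable (fun ω : Path n => f (ω i.succ)) Q := by
  rw [← hQ.1.2.2 i] at hi
  exact (integrable_map_measure hf.aestronglyMeasurable
    (measurable_pi_apply i.succ).aemeasurable).1 hi

lemma integral_marg (hQ : Q ∈ MSet s₀ μ) (i : Fin n) {f : ℝ → ℝ} (hf : Measurable f) :
    ∫ ω, f (ω i.succ) ∂Q = ∫ x, f x ∂(μ i) := by
  rw [← hQ.1.2.2 i, integral_map (measurable_pi_apply i.succ).aemeasurable
    hf.aestronglyMeasurable]

lemma integrable_coord (hmom : ∀ i, Integrable (fun x => x) (μ i)) (hQ : Q ∈ MSet s₀ μ)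
    (i : Fin (n + 1)) : Integrable (fun ω : Path n => ω i) Q := by
  have := hQ.1.1
  refine Fin.cases ?_ (fun i => ?_) i
  · refine (integrable_const s₀).congr ?_
    filter_upwards [ae_Omega hQ] with ω h using h.1.symm
  · exact integrable_marg hQ i measurable_id (hmom i)

lemma integrable_opt {o : ℝ → ℝ → ℝ} (ν : Measure ℝ) [IsProbabilityMeasure ν]
    (hν : Integrable (fun x => x) ν) (ho : ∀ K, Measurable (o K))
    (hob : ∀ K x, |o K x| ≤ |K| + |x|) (K : ℝ) : Integrable (o K) ν := by
  refine ((integrable_const |K|).add hν.abs).mono' (ho K).aestronglyMeasurable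
    (ae_of_all _ (fun x => hob K x))

lemma static_price_integral [∀ i, IsProbabilityMeasure (μ i)]
    (hmom : ∀ i, Integrable (fun x => x) (μ i)) (hQ : Q ∈ MSet s₀ μ)
    {o : ℝ → ℝ → ℝ} (ho : ∀ K, Measurable (o K))
    (hob : ∀ K x, |o K x| ≤ |K| + |x|) (X : Static n) :
    Integrable (fun ω : Path n => X.price (fun i K => o K (ω i.succ))) Q ∧
    ∫ ω : Path n, X.price (fun i K => o K (ω i.succ)) ∂Q =
      X.price (fun i K => ∫ x, o K x ∂(μ i)) := by
  have := hQ.1.1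
  have h1 : ∀ k : Fin X.m, Integrable
      (fun ω : Path n => X.coeff k * o (X.strike k) (ω (X.idx k).succ)) Q := fun k =>
    (integrable_marg hQ _ (ho _) (integrable_opt _ (hmom _) ho hob _)).const_mul _
  have h2 := integrable_finsetSum Finset.univ (fun k _ => h1 k)
  refine ⟨(integrable_const X.const).add h2, ?_⟩
  unfold Static.price
  rw [integral_add (integrable_const _) h2, integral_finsetSum _ (fun k _ => h1 k)]
  simp only [integral_const, probReal_univ, one_smul]
  congr 1
  refine Finset.sum_congr rfl (fun k _ => ?_)
  rw [integral_const_mul, integral_marg hQ _ (ho _)]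

lemma abs_call_le (K x : ℝ) : |max (x - K) 0| ≤ |K| + |x| := by
  rw [abs_of_nonneg (le_max_right _ _)]
  refine max_le ?_ (by positivity)
  linarith [neg_abs_le K, le_abs_self x]

lemma abs_put_le (K x : ℝ) : |max (K - x) 0| ≤ |K| + |x| := by
  rw [abs_of_nonneg (le_max_right _ _)]
  refine max_le ?_ (by positivity)
  linarith [le_abs_self K, neg_abs_le x]

lemma gains_integrable (hmom : ∀ i, Integrable (fun x => x) (μ i)) (hQ : Q ∈ MSet s₀ μ)
    (D : Dyn n) : Integrable (fun ω => D.gains ω) Q := by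
  unfold Dyn.gains
  refine integrable_finsetSum Finset.univ (fun j _ => ?_)
  obtain ⟨C, hC⟩ := D.bdd j
  exact integrable_bdd_mul (T := restr j) (measurable_restr j)
    ((integrable_coord hmom hQ _).sub (integrable_coord hmom hQ _)) (D.meas j) hC

lemma gains_nonpos (hmom : ∀ i, Integrable (fun x => x) (μ i)) (hQ : Q ∈ MSet s₀ μ)
    (D : Dyn n) (hD : ∀ j, ∀ ω ∈ Omega n s₀, 0 ≤ D.pos j (restr j ω)) :
    ∫ ω, D.gains ω ∂Q ≤ 0 := by
  unfold Dyn.gains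
  rw [integral_finsetSum]
  · refine Finset.sum_nonpos (fun j _ => ?_)
    obtain ⟨C, hC⟩ := D.bdd j
    have h := superm_bdd (Q := Q) (T := restr j) (Y := fun ω => ω j.succ)
      (X := fun ω => ω j.castSucc) (measurable_restr j)
      (measurable_pi_apply _) (integrable_coord hmom hQ _)
      (by filter_upwards [ae_Omega hQ] with ω h using h.2 _)
      (measurable_pi_apply _) (integrable_coord hmom hQ _)
      (by filter_upwards [ae_Omega hQ] with ω h using h.2 _)
      (hQ.2 j) (g := fun x => max (D.pos j x) 0) (C := C) ((D.meas j).max measurable_const)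
      (fun a => le_max_right _ _) (fun a => by
        rw [abs_of_nonneg (le_max_right _ _)]
        exact max_le ((le_abs_self _).trans (hC a)) ((abs_nonneg _).trans (hC a)))
    refine le_of_eq_of_le (integral_congr_ae ?_) h
    filter_upwards [ae_Omega hQ] with ω hω
    rw [max_eq_left (hD j ω hω)]
  · intro j _
    obtain ⟨C, hC⟩ := D.bdd j
    exact integrable_bdd_mul (T := restr j) (measurable_restr j)
      ((integrable_coord hmom hQ _).sub (integrable_coord hmom hQ _)) (D.meas j) hC

end MS

/-! ### Linear growth and the Hahn–Banach functional -/

/-- Linear growth on `Omega`. -/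
def LinGrowth {n : ℕ} (s₀ : ℝ) (f : Path n → ℝ) : Prop :=
  ∃ C : ℝ, 0 ≤ C ∧ ∀ ω ∈ Omega n s₀, |f ω| ≤ C * (1 + ∑ i : Fin n, ω i.succ)

lemma sum_nonneg_Omega {n : ℕ} {s₀ : ℝ} {ω : Path n} (hω : ω ∈ Omega n s₀) :
    0 ≤ ∑ i : Fin n, ω i.succ := Finset.sum_nonneg (fun i _ => hω.2 _)

lemma LinGrowth.add {n : ℕ} {s₀ : ℝ} {f g : Path n → ℝ} (hf : LinGrowth s₀ f)
    (hg : LinGrowth s₀ g) : LinGrowth s₀ (f + g) := by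
  obtain ⟨C, hC0, hC⟩ := hf
  obtain ⟨C', hC0', hC'⟩ := hg
  refine ⟨C + C', by positivity, fun ω hω => ?_⟩
  rw [add_mul]
  exact (abs_add_le _ _).trans (add_le_add (hC ω hω) (hC' ω hω))

lemma LinGrowth.smul {n : ℕ} {s₀ : ℝ} {f : Path n → ℝ} (a : ℝ) (hf : LinGrowth s₀ f) :
    LinGrowth s₀ (a • f) := by
  obtain ⟨C, hC0, hC⟩ := hf
  refine ⟨|a| * C, by positivity, fun ω hω => ?_⟩
  rw [Pi.smul_apply, smul_eq_mul, abs_mul, mul_assoc]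
  exact mul_le_mul_of_nonneg_left (hC ω hω) (abs_nonneg a)

/-- The space of functions of linear growth. -/
def growthSpace (n : ℕ) (s₀ : ℝ) : Submodule ℝ (Path n → ℝ) where
  carrier := {f | LinGrowth s₀ f}
  add_mem' := fun hf hg => hf.add hg
  zero_mem' := ⟨0, le_rfl, fun ω _ => by simp⟩
  smul_mem' := fun a _ hf => hf.smul a

/-- Call prices. -/
def cpr {n : ℕ} (μ : Fin n → Measure ℝ) : Fin n → ℝ → ℝ := fun i K => ∫ x, max (x - K) 0 ∂(μ i)

/-- Costs of call-based superhedges of `f`. -/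
def costs {n : ℕ} (s₀ : ℝ) (μ : Fin n → Measure ℝ) (f : Path n → ℝ) : Set ℝ :=
  {q | ∃ (X : Static n) (D : Dyn n), D.Nonneg ∧ q = X.price (cpr μ) ∧
    ∀ ω ∈ Omega n s₀, f ω ≤ X.callPayoff ω + D.gains ω}

section HB
variable {n : ℕ} {s₀ : ℝ} {μ : Fin n → Measure ℝ}

lemma costs_nonempty {f : Path n → ℝ} (hf : LinGrowth s₀ f) : (costs s₀ μ f).Nonempty := by
  obtain ⟨C, hC0, hC⟩ := hf
  refine ⟨_, stAdd (stConst n C) (stAll n C 0 le_rfl), dZero n, dZero_nonneg, rfl, ?_⟩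
  intro ω hω
  rw [callPayoff_eq, stAdd_price, stConst_price, stAll_price, dZero_gains]
  have : ∑ i : Fin n, max (ω i.succ - 0) 0 = ∑ i : Fin n, ω i.succ :=
    Finset.sum_congr rfl (fun i _ => by rw [sub_zero, max_eq_left (hω.2 _)])
  rw [this]
  linarith [le_abs_self (f ω), hC ω hω]

lemma costs_lower [∀ i, IsProbabilityMeasure (μ i)]
    (hmom : ∀ i, Integrable (fun x => x) (μ i)) {Q : Measure (Path n)} (hQ : Q ∈ MSet s₀ μ)
    {g : Path n → ℝ} (hg : Integrable g Q) {f : Path n → ℝ}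
    (hgf : ∀ ω ∈ Omega n s₀, g ω ≤ f ω) {q : ℝ} (hq : q ∈ costs s₀ μ f) : ∫ ω, g ω ∂Q ≤ q := by
  obtain ⟨X, D, hD, rfl, h⟩ := hq
  obtain ⟨h1, h2⟩ := static_price_integral hmom hQ (o := fun K x => max (x - K) 0)
    (fun K => by fun_prop) abs_call_le X
  have h3 : ∫ ω, g ω ∂Q ≤ ∫ ω, (X.callPayoff ω + D.gains ω) ∂Q := by
    refine integral_mono_ae hg (h1.add (gains_integrable hmom hQ D)) ?_
    filter_upwards [ae_Omega hQ] with ω hω using (hgf ω hω).trans (h ω hω)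
  have h4 := integral_add h1 (gains_integrable hmom hQ D)
  have h5 := gains_nonpos hmom hQ D (fun j ω _ => hD j _)
  have h6 : X.price (cpr μ) = X.price (fun i K => ∫ x, max (x - K) 0 ∂(μ i)) := rfl
  have h7 : ∫ ω, (X.callPayoff ω + D.gains ω) ∂Q = ∫ ω, (X.price (fun i K => max (ω i.succ - K) 0)
    + D.gains ω) ∂Q := rfl
  linarith

lemma costs_bddBelow [∀ i, IsProbabilityMeasure (μ i)]
    (hmom : ∀ i, Integrable (fun x => x) (μ i)) {Q : Measure (Path n)} (hQ : Q ∈ MSet s₀ μ)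
    {f : Path n → ℝ} (hf : LinGrowth s₀ f) : BddBelow (costs s₀ μ f) := by
  have := hQ.1.1
  obtain ⟨C, hC0, hC⟩ := hf
  have hi : Integrable (fun ω : Path n => -(C * (1 + ∑ i : Fin n, ω i.succ))) Q :=
    (((integrable_const (1 : ℝ)).add (integrable_finsetSum Finset.univ
      (fun (i : Fin n) _ => integrable_coord hmom hQ i.succ))).const_mul C).neg
  exact ⟨_, fun q hq => costs_lower hmom hQ hi
    (fun ω hω => by linarith [neg_abs_le (f ω), hC ω hω]) hq⟩

lemma costs_add {f g : Path n → ℝ} {a b : ℝ} (ha : a ∈ costs s₀ μ f) (hb : b ∈ costs s₀ μ g) :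
    a + b ∈ costs s₀ μ (f + g) := by
  obtain ⟨X, D, hD, rfl, h⟩ := ha
  obtain ⟨Y, E, hE, rfl, h'⟩ := hb
  refine ⟨stAdd X Y, dAdd D E, dAdd_nonneg hD hE, (stAdd_price _ _ _).symm, fun ω hω => ?_⟩
  rw [callPayoff_eq, stAdd_price, dAdd_gains, Pi.add_apply, ← callPayoff_eq, ← callPayoff_eq]
  linarith [h ω hω, h' ω hω]

lemma costs_smul {f : Path n → ℝ} {a c : ℝ} (hc : 0 ≤ c) (ha : a ∈ costs s₀ μ f) :
    c * a ∈ costs s₀ μ (c • f) := by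
  obtain ⟨X, D, hD, rfl, h⟩ := ha
  refine ⟨stSmul c X, dSmul c D, dSmul_nonneg hc hD, (stSmul_price _ _ _).symm, fun ω hω => ?_⟩
  rw [callPayoff_eq, stSmul_price, dSmul_gains, Pi.smul_apply, ← callPayoff_eq, smul_eq_mul,
    ← mul_add]
  exact mul_le_mul_of_nonneg_left (h ω hω) hc

/-- Hahn–Banach: a linear functional dominated by the superhedging price, touching it at `H`. -/
theorem exists_functional [∀ i, IsProbabilityMeasure (μ i)]
    (hmom : ∀ i, Integrable (fun x => x) (μ i)) (hne : (MSet s₀ μ).Nonempty)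
    {H : Path n → ℝ} (hH : LinGrowth s₀ H) {v : ℝ} (hv : ∀ q ∈ costs s₀ μ H, v ≤ q) :
    ∃ L : (Path n → ℝ) →ₗ[ℝ] ℝ, v ≤ L H ∧
      ∀ f, LinGrowth s₀ f → ∀ q ∈ costs s₀ μ f, L f ≤ q := by
  obtain ⟨Q, hQ⟩ := hne
  let E := growthSpace n s₀
  let N : E → ℝ := fun f => sInf (costs s₀ μ (f : Path n → ℝ))
  have hbd : ∀ f : E, BddBelow (costs s₀ μ (f : Path n → ℝ)) := fun f =>
    costs_bddBelow hmom hQ f.2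
  have hnon : ∀ f : E, (costs s₀ μ (f : Path n → ℝ)).Nonempty := fun f => costs_nonempty f.2
  have N_add : ∀ x y, N (x + y) ≤ N x + N y := by
    intro x y
    refine le_of_forall_pos_le_add (fun ε hε => ?_)
    obtain ⟨a, ha, ha'⟩ := exists_lt_of_csInf_lt (hnon x) (lt_add_of_pos_right (N x) (half_pos hε))
    obtain ⟨b, hb, hb'⟩ := exists_lt_of_csInf_lt (hnon y) (lt_add_of_pos_right (N y) (half_pos hε))
    have := csInf_le (hbd (x + y)) (costs_add ha hb)
    change N (x + y) ≤ _ at this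
    linarith
  have N_le : ∀ c : ℝ, 0 < c → ∀ x, N (c • x) ≤ c * N x := by
    intro c hc x
    have h1 : N (c • x) / c ≤ N x := by
      refine le_csInf (hnon x) (fun a ha => ?_)
      rw [div_le_iff₀ hc, mul_comm]
      exact csInf_le (hbd (c • x)) (costs_smul hc.le ha)
    rw [div_le_iff₀ hc] at h1
    linarith
  have N_hom : ∀ c : ℝ, 0 < c → ∀ x, N (c • x) = c * N x := by
    intro c hc x
    refine le_antisymm (N_le c hc x) ?_
    have := N_le c⁻¹ (inv_pos.2 hc) (c • x)
    rw [smul_smul, inv_mul_cancel₀ hc.ne', one_smul] at this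
    calc c * N x ≤ c * (c⁻¹ * N (c • x)) := mul_le_mul_of_nonneg_left this hc.le
      _ = N (c • x) := by field_simp
  have N_0 : N 0 = 0 := by
    have := N_hom 2 (by norm_num) 0
    rw [smul_zero] at this
    linarith
  let h : E := ⟨H, hH⟩
  have hvN : v ≤ N h := le_csInf (hnon h) hv
  by_cases hh : h = 0
  · -- degenerate case
    obtain ⟨g, -, hg⟩ := exists_extension_of_le_sublinear (⊥ : E →ₗ.[ℝ] ℝ) N N_hom N_add (by
      rintro ⟨x, hx⟩
      have hx0 : x = 0 := (Submodule.mem_bot ℝ).1 hx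
      subst hx0
      have : (⊥ : E →ₗ.[ℝ] ℝ) ⟨0, hx⟩ = 0 := LinearPMap.map_zero _
      rw [this]
      exact N_0.ge)
    obtain ⟨L, hL⟩ := LinearMap.exists_extend g
    have hL' : ∀ f : E, L f = g f := fun f => LinearMap.congr_fun hL f
    refine ⟨L, ?_, fun f hf q hq => ?_⟩
    · have : L H = g h := hL' h
      rw [this, hh, map_zero]
      rw [hh, N_0] at hvN
      exact hvN
    · have : L f = g ⟨f, hf⟩ := hL' ⟨f, hf⟩
      rw [this]
      exact (hg _).trans (csInf_le (hbd ⟨f, hf⟩) hq)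
  · obtain ⟨g, hg1, hg⟩ := exists_extension_of_le_sublinear
      (LinearPMap.mkSpanSingleton (K := ℝ) h (N h) hh) N N_hom N_add (by
      rintro ⟨x, hx⟩
      obtain ⟨c, rfl⟩ := Submodule.mem_span_singleton.1 hx
      unfold LinearPMap.mkSpanSingleton
      rw [LinearPMap.mkSpanSingleton'_apply]
      change c * N h ≤ N (c • h)
      rcases lt_trichotomy c 0 with hc | hc | hc
      · have h1 := N_hom (-c) (by linarith) h
        have h2 := N_add (c • h) (-c • h)
        rw [← add_smul, add_neg_cancel, zero_smul, N_0, h1] at h2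
        linarith
      · rw [hc, zero_smul, N_0, zero_mul]
      · rw [N_hom c hc])
    obtain ⟨L, hL⟩ := LinearMap.exists_extend g
    have hL' : ∀ f : E, L f = g f := fun f => LinearMap.congr_fun hL f
    refine ⟨L, ?_, fun f hf q hq => ?_⟩
    · have h1 : L H = g h := hL' h
      have h2 := hg1 ⟨h, Submodule.mem_span_singleton_self h⟩
      have h3 := LinearPMap.mkSpanSingleton_apply ℝ (σ := RingHom.id ℝ) ℝ hh (N h)
      rw [h1]
      exact hvN.trans (h2.trans h3).ge
    · have : L f = g ⟨f, hf⟩ := hL' ⟨f, hf⟩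
      rw [this]
      exact (hg _).trans (csInf_le (hbd ⟨f, hf⟩) hq)

end HB


/-! ### Call prices determine the marginals -/

lemma call_spread_tendsto (ν : Measure ℝ) [IsProbabilityMeasure ν] (K : ℝ) :
    Tendsto (fun m : ℕ => ∫ x, ((m : ℝ) + 1) * (max (x - K) 0 - max (x - (K + 1 / ((m : ℝ) + 1))) 0) ∂ν)
      atTop (𝓝 (ν.real (Ioi K))) := by
  have h0 : ν.real (Ioi K) = ∫ x, (Ioi K).indicator (fun _ => (1 : ℝ)) x ∂ν := by
    rw [integral_indicator_const _ measurableSet_Ioi]; simp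
  rw [h0]
  have hpos : ∀ m : ℕ, (0 : ℝ) < (m : ℝ) + 1 := fun m => by positivity
  refine tendsto_integral_of_dominated_convergence (fun _ => (1 : ℝ)) ?_ (integrable_const _) ?_ ?_
  · intro m
    exact (by fun_prop : Measurable _).aestronglyMeasurable
  · intro m
    refine ae_of_all _ (fun x => ?_)
    have hm := hpos m
    have hd : ((m : ℝ) + 1) * (1 / ((m : ℝ) + 1)) = 1 := by field_simp
    have hd0 : 0 < 1 / ((m : ℝ) + 1) := by positivity
    set d := 1 / ((m : ℝ) + 1)
    have h1 : 0 ≤ max (x - K) 0 - max (x - (K + d)) 0 :=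
      sub_nonneg.2 (max_le_max (by linarith) le_rfl)
    have h2 : max (x - K) 0 - max (x - (K + d)) 0 ≤ d := by
      have : max (x - K) 0 ≤ max (x - (K + d)) 0 + d :=
        max_le (by linarith [le_max_left (x - (K + d)) 0]) (by linarith [le_max_right (x - (K + d)) 0])
      linarith
    rw [Real.norm_eq_abs, abs_of_nonneg (mul_nonneg hm.le h1)]
    calc _ ≤ ((m : ℝ) + 1) * d := mul_le_mul_of_nonneg_left h2 hm.le
      _ = 1 := hd
  · refine ae_of_all _ (fun x => ?_)
    by_cases hx : K < x
    · rw [indicator_of_mem (by exact hx)]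
      refine tendsto_const_nhds.congr' ?_
      have := (tendsto_one_div_add_atTop_nhds_zero_nat (𝕜 := ℝ)).eventually
        (gt_mem_nhds (sub_pos.2 hx))
      filter_upwards [this] with m hm
      rw [max_eq_left (by linarith), max_eq_left (by linarith)]
      have := hpos m
      field_simp
      ring
    · rw [indicator_of_notMem (by simpa using hx)]
      refine tendsto_const_nhds.congr (fun m => ?_)
      have : (0 : ℝ) < 1 / ((m : ℝ) + 1) := by positivity
      rw [max_eq_right (by linarith), max_eq_right (by linarith)]
      simp

lemma integrable_call (ν : Measure ℝ) [IsProbabilityMeasure ν]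
    (hν : Integrable (fun x => x) ν) (K : ℝ) : Integrable (fun x => max (x - K) 0) ν :=
  integrable_opt (o := fun K x => max (x - K) 0) ν hν (fun K => by fun_prop) abs_call_le K

lemma measure_eq_of_calls (ν ν' : Measure ℝ) [IsProbabilityMeasure ν] [IsProbabilityMeasure ν']
    (hν : Integrable (fun x => x) ν) (hν' : Integrable (fun x => x) ν')
    (h0 : ν (Iio 0) = 0) (h0' : ν' (Iio 0) = 0)
    (h : ∀ K : ℝ, 0 ≤ K → ∫ x, max (x - K) 0 ∂ν = ∫ x, max (x - K) 0 ∂ν') : ν = ν' := by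
  refine Measure.ext_of_Iic ν ν' (fun K => ?_)
  rcases lt_or_ge K 0 with hK | hK
  · have hs : Iic K ⊆ Iio 0 := fun x hx => lt_of_le_of_lt hx hK
    rw [measure_mono_null hs h0, measure_mono_null hs h0']
  · have h1 : ν.real (Ioi K) = ν'.real (Ioi K) := by
      refine tendsto_nhds_unique (call_spread_tendsto ν K) ?_
      refine (call_spread_tendsto ν' K).congr (fun m => ?_)
      have hm : (0 : ℝ) ≤ 1 / ((m : ℝ) + 1) := by positivity
      rw [integral_const_mul, integral_const_mul,
        integral_sub (integrable_call _ hν _) (integrable_call _ hν _),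
        integral_sub (integrable_call _ hν' _) (integrable_call _ hν' _), h _ hK,
        h _ (add_nonneg hK hm)]
    have h2 : ν (Ioi K) = ν' (Ioi K) :=
      (ENNReal.toReal_eq_toReal_iff' (measure_ne_top _ _) (measure_ne_top _ _)).1 h1
    rw [← compl_Ioi, prob_compl_eq_one_sub measurableSet_Ioi,
      prob_compl_eq_one_sub measurableSet_Ioi, h2]

lemma cpr_tendsto (ν : Measure ℝ) [IsProbabilityMeasure ν] (hν : Integrable (fun x => x) ν) :
    Tendsto (fun k : ℕ => ∫ x, max (x - (k : ℝ) / 2) 0 ∂ν) atTop (𝓝 0) := by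
  suffices hh : Tendsto (fun k : ℕ => ∫ x, max (x - (k : ℝ) / 2) 0 ∂ν) atTop
      (𝓝 (∫ x, (0 : ℝ) ∂ν)) by simpa using hh
  refine tendsto_integral_of_dominated_convergence (fun x => |x|) ?_ hν.abs ?_ ?_
  · intro m
    exact (by fun_prop : Measurable _).aestronglyMeasurable
  · intro m
    refine ae_of_all _ (fun x => ?_)
    rw [Real.norm_eq_abs, abs_of_nonneg (le_max_right _ _)]
    have : (0 : ℝ) ≤ (m : ℝ) / 2 := by positivity
    exact max_le (by linarith [le_abs_self x]) (abs_nonneg _)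
  · refine ae_of_all _ (fun x => ?_)
    refine tendsto_const_nhds.congr' ?_
    have := (tendsto_natCast_atTop_atTop (R := ℝ)).eventually_ge_atTop (2 * x)
    filter_upwards [this] with m hm
    rw [max_eq_right (by linarith)]

/-! ### Representation of the functional -/

/-- The global weight. -/
def wt {n : ℕ} (ω : Path n) : ℝ := 1 + ∑ i : Fin (n + 1), |ω i|

/-- Global linear growth. -/
def GG {n : ℕ} (f : Path n → ℝ) : Prop := ∃ C : ℝ, 0 ≤ C ∧ ∀ ω, |f ω| ≤ C * wt ω

lemma wt_ge_one {n : ℕ} (ω : Path n) : 1 ≤ wt ω := by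
  unfold wt
  have : 0 ≤ ∑ i : Fin (n + 1), |ω i| := Finset.sum_nonneg (fun i _ => abs_nonneg _)
  linarith

lemma wt_cont {n : ℕ} : Continuous (wt : Path n → ℝ) := by
  unfold wt; fun_prop

lemma abs_le_wt {n : ℕ} (ω : Path n) (i : Fin (n + 1)) : |ω i| ≤ wt ω := by
  have := Finset.single_le_sum (f := fun i => |ω i|) (fun i _ => abs_nonneg _) (Finset.mem_univ i)
  unfold wt
  linarith

lemma wt_Omega {n : ℕ} {s₀ : ℝ} {ω : Path n} (hω : ω ∈ Omega n s₀) :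
    wt ω = 1 + s₀ + ∑ i : Fin n, ω i.succ := by
  unfold wt
  rw [Fin.sum_univ_succ, abs_of_nonneg (hω.2 0), hω.1]
  have : ∑ i : Fin n, |ω i.succ| = ∑ i : Fin n, ω i.succ :=
    Finset.sum_congr rfl (fun i _ => abs_of_nonneg (hω.2 _))
  rw [this]; ring

lemma GG.lin {n : ℕ} {s₀ : ℝ} (hs : 0 < s₀) {f : Path n → ℝ} (hf : GG f) : LinGrowth s₀ f := by
  obtain ⟨C, hC0, hC⟩ := hf
  refine ⟨C * (1 + s₀), by positivity, fun ω hω => (hC ω).trans ?_⟩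
  rw [wt_Omega hω, mul_assoc]
  refine mul_le_mul_of_nonneg_left ?_ hC0
  nlinarith [sum_nonneg_Omega hω]

lemma GG.bdd {n : ℕ} {f : Path n → ℝ} {C : ℝ} (h : ∀ ω, |f ω| ≤ C) : GG f := by
  have hC : 0 ≤ C := (abs_nonneg _).trans (h 0)
  exact ⟨C, hC, fun ω => (h ω).trans (le_mul_of_one_le_right hC (wt_ge_one ω))⟩

lemma GG.add {n : ℕ} {f g : Path n → ℝ} (hf : GG f) (hg : GG g) : GG (fun ω => f ω + g ω) := by
  obtain ⟨C, hC0, hC⟩ := hf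
  obtain ⟨C', hC0', hC'⟩ := hg
  refine ⟨C + C', by positivity, fun ω => ?_⟩
  rw [add_mul]
  exact (abs_add_le _ _).trans (add_le_add (hC ω) (hC' ω))

lemma GG.bmul {n : ℕ} {f g : Path n → ℝ} {C : ℝ} (h : ∀ ω, |f ω| ≤ C) (hg : GG g) :
    GG (fun ω => f ω * g ω) := by
  have hC : 0 ≤ C := (abs_nonneg _).trans (h 0)
  obtain ⟨C', hC0', hC'⟩ := hg
  refine ⟨C * C', by positivity, fun ω => ?_⟩
  rw [abs_mul, mul_assoc]
  exact mul_le_mul (h ω) (hC' ω) (abs_nonneg _) hC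

lemma GG.neg {n : ℕ} {f : Path n → ℝ} (hf : GG f) : GG (fun ω => - f ω) := by
  obtain ⟨C, hC0, hC⟩ := hf
  exact ⟨C, hC0, fun ω => by rw [abs_neg]; exact hC ω⟩

lemma GG.coord {n : ℕ} (i : Fin (n + 1)) : GG (fun ω : Path n => ω i) :=
  ⟨1, zero_le_one, fun ω => by rw [one_mul]; exact abs_le_wt ω i⟩

lemma GG.sum {n : ℕ} {ι : Type*} (s : Finset ι) {f : ι → Path n → ℝ} (hf : ∀ i ∈ s, GG (f i)) :
    GG (fun ω => ∑ i ∈ s, f i ω) := by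
  induction s using Finset.induction_on with
  | empty => exact GG.bdd (C := 0) (by simp)
  | insert a s ha ih =>
    simp only [Finset.sum_insert ha]
    exact (hf a (Finset.mem_insert_self _ _)).add
      (ih (fun i hi => hf i (Finset.mem_insert_of_mem hi)))

/-- Cutoff function. -/
def cut {n : ℕ} (k : ℕ) (ω : Path n) : ℝ := max 0 (min 1 ((k : ℝ) + 1 - ‖ω‖))

lemma cut_cont {n : ℕ} (k : ℕ) : Continuous (cut k : Path n → ℝ) := by
  unfold cut; fun_prop

lemma cut_nonneg {n : ℕ} (k : ℕ) (ω : Path n) : 0 ≤ cut k ω := le_max_left _ _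

lemma cut_le_one {n : ℕ} (k : ℕ) (ω : Path n) : cut k ω ≤ 1 :=
  max_le zero_le_one (min_le_left _ _)

lemma cut_eq_one {n : ℕ} {k : ℕ} {ω : Path n} (h : ‖ω‖ ≤ k) : cut k ω = 1 := by
  unfold cut
  rw [min_eq_left (by linarith), max_eq_right zero_le_one]

lemma cut_supp {n : ℕ} (k : ℕ) : HasCompactSupport (cut k : Path n → ℝ) := by
  refine HasCompactSupport.intro (isCompact_closedBall (0 : Path n) ((k : ℝ) + 1)) (fun ω hω => ?_)
  unfold cut
  have : (k : ℝ) + 1 < ‖ω‖ := by simpa using hω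
  exact max_eq_left ((min_le_right _ _).trans (by linarith))

lemma cut_tendsto {n : ℕ} (f : Path n → ℝ) (ω : Path n) :
    Tendsto (fun k : ℕ => f ω * cut k ω) atTop (𝓝 (f ω)) := by
  refine tendsto_const_nhds.congr' ?_
  filter_upwards [(tendsto_natCast_atTop_atTop (R := ℝ)).eventually_ge_atTop ‖ω‖] with k hk
  rw [cut_eq_one hk, mul_one]

lemma cut_tail {n : ℕ} {s₀ : ℝ} {k : ℕ} (hk : 1 + s₀ ≤ k) {ω : Path n}
    (hω : ω ∈ Omega n s₀) :
    wt ω * (1 - cut k ω) ≤ (3 + n) * ∑ i : Fin n, max (ω i.succ - (k : ℝ) / 2) 0 := by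
  have hT0 : ∀ i : Fin n, 0 ≤ max (ω i.succ - (k : ℝ) / 2) 0 := fun i => le_max_right _ _
  have hT := Finset.sum_nonneg (fun i (_ : i ∈ Finset.univ) => hT0 i)
  rcases le_or_gt ‖ω‖ k with h | h
  · rw [cut_eq_one h, sub_self, mul_zero]
    positivity
  · have hex : ∃ i : Fin (n + 1), (k : ℝ) < |ω i| := by
      by_contra hcon
      push Not at hcon
      have := (pi_norm_le_iff_of_nonneg (x := ω) (Nat.cast_nonneg (α := ℝ) k)).2 (fun i => hcon i)
      linarith
    obtain ⟨i, hi⟩ := hex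
    rw [abs_of_nonneg (hω.2 i)] at hi
    have hi0 : i ≠ 0 := by
      rintro rfl
      rw [hω.1] at hi
      linarith
    obtain ⟨j, rfl⟩ := Fin.exists_succ_eq.2 hi0
    have h1 : (k : ℝ) / 2 ≤ ∑ i : Fin n, max (ω i.succ - (k : ℝ) / 2) 0 := by
      have := Finset.single_le_sum (f := fun i : Fin n => max (ω i.succ - (k : ℝ) / 2) 0)
        (fun i _ => hT0 i) (Finset.mem_univ j)
      refine le_trans ?_ this
      refine le_trans ?_ (le_max_left _ _)
      linarith
    have h2 : ∑ i : Fin n, ω i.succ ≤ ∑ i : Fin n, (max (ω i.succ - (k : ℝ) / 2) 0 + (k : ℝ) / 2) :=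
      Finset.sum_le_sum (fun i _ => by linarith [le_max_left (ω i.succ - (k : ℝ) / 2) 0])
    rw [Finset.sum_add_distrib] at h2
    simp only [Finset.sum_const, Finset.card_univ, Fintype.card_fin, nsmul_eq_mul] at h2
    set T := ∑ i : Fin n, max (ω i.succ - (k : ℝ) / 2) 0
    have h3 : wt ω ≤ (3 + n) * T := by
      rw [wt_Omega hω]
      have : (n : ℝ) * (k / 2) ≤ n * T := mul_le_mul_of_nonneg_left h1 (Nat.cast_nonneg n)
      linarith
    have h4 := cut_nonneg k ω
    have h5 := wt_ge_one ω
    nlinarith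

section Rep
variable {n : ℕ} {s₀ : ℝ} {μ : Fin n → Measure ℝ}

open scoped CompactlySupported

lemma L_mono {L : (Path n → ℝ) →ₗ[ℝ] ℝ}
    (hL : ∀ f, LinGrowth s₀ f → ∀ q ∈ costs s₀ μ f, L f ≤ q) {f g : Path n → ℝ}
    (hf : LinGrowth s₀ f) (hg : LinGrowth s₀ g) {D : Dyn n} (hD : D.Nonneg)
    (h : ∀ ω ∈ Omega n s₀, f ω ≤ g ω + D.gains ω) : L f ≤ L g := by
  have h1 : LinGrowth s₀ (f + (-1 : ℝ) • g) := hf.add (hg.smul _)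
  have h2 := hL _ h1 0 ⟨stConst n 0, D, hD, by rw [stConst_price], fun ω hω => by
    rw [callPayoff_eq, stConst_price]
    have := h ω hω
    simp only [Pi.add_apply, Pi.smul_apply, smul_eq_mul]
    linarith⟩
  rw [map_add, map_smul, smul_eq_mul] at h2
  linarith

lemma L_mono' {L : (Path n → ℝ) →ₗ[ℝ] ℝ}
    (hL : ∀ f, LinGrowth s₀ f → ∀ q ∈ costs s₀ μ f, L f ≤ q) {f g : Path n → ℝ}
    (hf : LinGrowth s₀ f) (hg : LinGrowth s₀ g)
    (h : ∀ ω ∈ Omega n s₀, f ω ≤ g ω) : L f ≤ L g :=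
  L_mono hL hf hg dZero_nonneg (fun ω hω => by rw [dZero_gains, add_zero]; exact h ω hω)

lemma L_static {L : (Path n → ℝ) →ₗ[ℝ] ℝ}
    (hL : ∀ f, LinGrowth s₀ f → ∀ q ∈ costs s₀ μ f, L f ≤ q) (X : Static n)
    {f : Path n → ℝ} (hf : LinGrowth s₀ f) (h : ∀ ω ∈ Omega n s₀, f ω = X.callPayoff ω) :
    L f = X.price (cpr μ) := by
  refine le_antisymm (hL f hf _ ⟨X, dZero n, dZero_nonneg, rfl, fun ω hω => ?_⟩) ?_
  · rw [dZero_gains, add_zero, h ω hω]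
  · have := hL _ (hf.smul (-1)) _ ⟨stSmul (-1) X, dZero n, dZero_nonneg, rfl, fun ω hω => by
      rw [dZero_gains, add_zero, callPayoff_eq, stSmul_price, ← callPayoff_eq, ← h ω hω]
      rfl⟩
    rw [stSmul_price, map_smul, smul_eq_mul] at this
    linarith

/-- Existence of a representing measure. -/
lemma exists_measure [∀ i, IsProbabilityMeasure (μ i)] (hs : 0 < s₀)
    (hmom : ∀ i, Integrable (fun x => x) (μ i)) {L : (Path n → ℝ) →ₗ[ℝ] ℝ}
    (hL : ∀ f, LinGrowth s₀ f → ∀ q ∈ costs s₀ μ f, L f ≤ q) :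
    ∃ π : Measure (Path n), IsFiniteMeasure π ∧ Integrable wt π ∧
      ∀ f : Path n → ℝ, Continuous f → GG f → ∫ ω, f ω ∂π = L f := by
  have gcc : ∀ f : C_c(Path n, ℝ), GG (f : Path n → ℝ) := fun f => by
    obtain ⟨C, hC⟩ := f.hasCompactSupport.exists_bound_of_continuous (map_continuous f)
    exact GG.bdd hC
  let Λ₀ : C_c(Path n, ℝ) →ₗ[ℝ] ℝ :=
    { toFun := fun f => L (f : Path n → ℝ)
      map_add' := fun f g => by rw [CompactlySupportedContinuousMap.coe_add, map_add]
      map_smul' := fun a f => by rw [CompactlySupportedContinuousMap.coe_smul, map_smul]; rfl }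
  let Λ : C_c(Path n, ℝ) →ₚ[ℝ] ℝ := PositiveLinearMap.mk₀ Λ₀ (fun f hf => by
    have := L_mono' hL (f := 0) (g := f) ((growthSpace n s₀).zero_mem) ((gcc f).lin hs)
      (fun ω _ => hf ω)
    rwa [map_zero] at this)
  let π := RealRMK.rieszMeasure Λ
  have hIntg : ∀ f : Path n → ℝ, Continuous f → HasCompactSupport f → ∫ ω, f ω ∂π = L f :=
    fun f hf hs => RealRMK.integral_rieszMeasure Λ ⟨⟨f, hf⟩, hs⟩
  have gcut : ∀ (k : ℕ) (f : Path n → ℝ), GG f → GG (fun ω => f ω * cut k ω) := fun k f hf => by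
    have := GG.bmul (f := cut k) (C := 1)
      (fun ω => by rw [abs_of_nonneg (cut_nonneg k ω)]; exact cut_le_one k ω) hf
    simpa only [mul_comm] using this
  have gwt : GG (wt : Path n → ℝ) := ⟨1, zero_le_one, fun ω => by
    rw [one_mul, abs_of_nonneg (zero_le_one.trans (wt_ge_one ω))]⟩
  have cs : ∀ (k : ℕ) (f : Path n → ℝ), HasCompactSupport (fun ω => f ω * cut k ω) :=
    fun k f => (cut_supp k).mul_left
  have hwt : Integrable (wt : Path n → ℝ) π := by
    refine ⟨wt_cont.aestronglyMeasurable, ?_⟩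
    rw [hasFiniteIntegral_iff_ofReal (ae_of_all _ (fun ω => zero_le_one.trans (wt_ge_one ω)))]
    have h1 : ∀ k : ℕ, ∫⁻ ω, ENNReal.ofReal (wt ω * cut k ω) ∂π ≤ ENNReal.ofReal (L wt) := by
      intro k
      have hc : Continuous (fun ω : Path n => wt ω * cut k ω) := wt_cont.mul (cut_cont k)
      rw [← ofReal_integral_eq_lintegral_ofReal (hc.integrable_of_hasCompactSupport (cs k wt))
        (ae_of_all _ (fun ω => mul_nonneg (zero_le_one.trans (wt_ge_one ω)) (cut_nonneg k ω))),
        hIntg _ hc (cs k wt)]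
      refine ENNReal.ofReal_le_ofReal (L_mono' hL ((gcut k _ gwt).lin hs) (gwt.lin hs) ?_)
      intro ω _
      exact mul_le_of_le_one_right (zero_le_one.trans (wt_ge_one ω)) (cut_le_one k ω)
    have h2 : ∫⁻ ω, ENNReal.ofReal (wt ω) ∂π =
        ∫⁻ ω, liminf (fun k : ℕ => ENNReal.ofReal (wt ω * cut k ω)) atTop ∂π := by
      refine lintegral_congr (fun ω => ?_)
      exact ((ENNReal.tendsto_ofReal (cut_tendsto wt ω)).liminf_eq).symm
    rw [h2]
    refine (lintegral_liminf_le (fun k => (wt_cont.mul (cut_cont k)).measurable.ennreal_ofReal)).trans_lt ?_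
    refine lt_of_le_of_lt ?_ (ENNReal.ofReal_lt_top (r := L wt))
    exact (liminf_le_liminf (Eventually.of_forall h1)).trans_eq (liminf_const _)
  have hfin : IsFiniteMeasure π := by
    have h1 : Integrable (fun _ : Path n => (1 : ℝ)) π := hwt.mono'
      aestronglyMeasurable_const (ae_of_all _ (fun ω => by simpa using wt_ge_one ω))
    exact (integrable_const_iff_isFiniteMeasure one_ne_zero).1 h1
  refine ⟨π, hfin, hwt, fun f hf hg => ?_⟩
  have ht1 : Tendsto (fun k : ℕ => ∫ ω, f ω * cut k ω ∂π) atTop (𝓝 (∫ ω, f ω ∂π)) := by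
    obtain ⟨C, hC0, hC⟩ := hg
    refine tendsto_integral_of_dominated_convergence (fun ω => C * wt ω)
      (fun k => (hf.mul (cut_cont k)).aestronglyMeasurable) (hwt.const_mul C)
      (fun k => ae_of_all _ (fun ω => ?_)) (ae_of_all _ (fun ω => cut_tendsto f ω))
    rw [Real.norm_eq_abs, abs_mul, abs_of_nonneg (cut_nonneg k ω)]
    exact (mul_le_of_le_one_right (abs_nonneg _) (cut_le_one k ω)).trans (hC ω)
  have ht2 : Tendsto (fun k : ℕ => ∫ ω, f ω * cut k ω ∂π) atTop (𝓝 (L f)) := by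
    have hg' := hg
    obtain ⟨C, hC0, hC⟩ := hg
    have hz : Tendsto (fun k : ℕ => (C * (3 + n)) * ∑ i, cpr μ i ((k : ℝ) / 2)) atTop (𝓝 0) := by
      have := (tendsto_finsetSum Finset.univ
        (fun i (_ : i ∈ Finset.univ) => cpr_tendsto (μ i) (hmom i))).const_mul (C * (3 + (n : ℝ)))
      simpa [cpr] using this
    rw [tendsto_iff_dist_tendsto_zero]
    refine squeeze_zero' (Eventually.of_forall (fun _ => dist_nonneg)) ?_ hz
    filter_upwards [(tendsto_natCast_atTop_atTop (R := ℝ)).eventually_ge_atTop (1 + s₀)] with k hk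
    rw [hIntg (fun ω => f ω * cut k ω) (hf.mul (cut_cont k)) (cs k f), Real.dist_eq]
    have hk2 : (0 : ℝ) ≤ (k : ℝ) / 2 := by positivity
    have key : ∀ a : ℝ, |a| = 1 →
        a * (L (fun ω => f ω * cut k ω) - L f) ≤ (C * (3 + n)) * ∑ i, cpr μ i ((k : ℝ) / 2) := by
      intro a ha
      have h1 : LinGrowth s₀ (a • ((fun ω => f ω * cut k ω) + (-1 : ℝ) • f)) :=
        (((gcut k f hg').lin hs).add ((hg'.lin hs).smul _)).smul _
      have h2 := hL _ h1 _ ⟨stAll n (C * (3 + n)) ((k : ℝ) / 2) hk2, dZero n, dZero_nonneg, rfl,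
        fun ω hω => by
          rw [dZero_gains, add_zero, callPayoff_eq, stAll_price]
          have h3 := cut_tail hk hω
          have h4 : a * (f ω * cut k ω + -1 * f ω) ≤ |f ω| * (1 - cut k ω) := by
            refine (le_abs_self _).trans ?_
            have : f ω * cut k ω + -1 * f ω = -(f ω * (1 - cut k ω)) := by ring
            rw [abs_mul, ha, one_mul, this, abs_neg, abs_mul,
              abs_of_nonneg (sub_nonneg.2 (cut_le_one k ω))]
          have h5 : |f ω| * (1 - cut k ω) ≤ C * (wt ω * (1 - cut k ω)) := by
            rw [← mul_assoc]
            exact mul_le_mul_of_nonneg_right (hC ω) (sub_nonneg.2 (cut_le_one k ω))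
          have h6 := mul_le_mul_of_nonneg_left h3 hC0
          simp only [Pi.smul_apply, Pi.add_apply, smul_eq_mul]
          rw [mul_assoc]
          linarith⟩
      rw [stAll_price, map_smul, map_add, map_smul, smul_eq_mul, smul_eq_mul] at h2
      linarith
    refine abs_le.2 ⟨?_, ?_⟩
    · have := key (-1) (by simp)
      linarith
    · have := key 1 (by simp)
      linarith
  exact tendsto_nhds_unique ht1 ht2

end Rep


/-! ### The representing measure is a calibrated supermartingale measure -/

section Mem
variable {n : ℕ} {s₀ : ℝ} {μ : Fin n → Measure ℝ}

/-- Trading only at time `j`. -/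
def dSingle {n : ℕ} (j : Fin n) (g : (Fin j → ℝ) → ℝ) (hg : Measurable g) (C : ℝ)
    (hC : ∀ x, |g x| ≤ C) : Dyn n where
  pos := Function.update (fun _ _ => (0 : ℝ)) j g
  meas := by
    intro i
    by_cases h : i = j
    · subst h; simpa using hg
    · rw [Function.update_of_ne h]; exact measurable_const
  bdd := by
    intro i
    by_cases h : i = j
    · subst h; exact ⟨C, by simpa using hC⟩
    · rw [Function.update_of_ne h]; exact ⟨0, by simp⟩

lemma dSingle_gains {n : ℕ} (j : Fin n) (g : (Fin j → ℝ) → ℝ) (hg : Measurable g) (C : ℝ)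
    (hC : ∀ x, |g x| ≤ C) (ω : Path n) :
    (dSingle j g hg C hC).gains ω = g (restr j ω) * (ω j.succ - ω j.castSucc) := by
  unfold Dyn.gains
  rw [Finset.sum_eq_single j]
  · simp [dSingle]
  · intro i _ hi
    simp [dSingle, Function.update_of_ne hi]
  · simp

lemma dSingle_nonneg {n : ℕ} (j : Fin n) (g : (Fin j → ℝ) → ℝ) (hg : Measurable g) (C : ℝ)
    (hC : ∀ x, |g x| ≤ C) (h0 : ∀ x, 0 ≤ g x) : (dSingle j g hg C hC).Nonneg := by
  intro i x
  by_cases h : i = j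
  · subst h; simpa [dSingle] using h0 x
  · simp [dSingle, Function.update_of_ne h]

lemma GG.integrable {π : Measure (Path n)} (hwt : Integrable wt π) {f : Path n → ℝ}
    (hf : Measurable f) (hg : GG f) : Integrable f π := by
  obtain ⟨C, hC0, hC⟩ := hg
  exact (hwt.const_mul C).mono' hf.aestronglyMeasurable (ae_of_all _ hC)

lemma mem_MSet [∀ i, IsProbabilityMeasure (μ i)] (hs : 0 < s₀)
    (hsupp : ∀ i, μ i (Set.Iio 0) = 0)
    (hmom : ∀ i, Integrable (fun x => x) (μ i)) {L : (Path n → ℝ) →ₗ[ℝ] ℝ}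
    (hL : ∀ f, LinGrowth s₀ f → ∀ q ∈ costs s₀ μ f, L f ≤ q)
    {π : Measure (Path n)} [IsFiniteMeasure π] (hwt : Integrable wt π)
    (hπ : ∀ f : Path n → ℝ, Continuous f → GG f → ∫ ω, f ω ∂π = L f) : π ∈ MSet s₀ μ := by
  -- probability
  have hprob : IsProbabilityMeasure π := by
    have h1 := hπ (fun _ => 1) continuous_const (GG.bdd (C := 1) (by simp))
    have h2 := L_static hL (stConst n 1) (f := fun _ => 1) ((GG.bdd (C := 1) (by simp)).lin hs)
      (fun ω _ => by rw [callPayoff_eq, stConst_price])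
    rw [h2, stConst_price] at h1
    simp only [integral_const, smul_eq_mul, mul_one] at h1
    exact isProbabilityMeasure_iff_real.2 h1
  -- support
  have hzero : ∀ f : Path n → ℝ, Continuous f → (∀ ω, 0 ≤ f ω) → (∀ ω, f ω ≤ 1) →
      (∀ ω ∈ Omega n s₀, f ω = 0) → ∀ᵐ ω ∂π, f ω = 0 := by
    intro f hf h0 h1 h
    have hg : GG f := GG.bdd (C := 1) (fun ω => by rw [abs_of_nonneg (h0 ω)]; exact h1 ω)
    have h2 := hπ f hf hg
    have h3 := L_static hL (stConst n 0) (hg.lin hs)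
      (fun ω hω => by rw [callPayoff_eq, stConst_price, h ω hω])
    rw [h3, stConst_price] at h2
    exact (integral_eq_zero_iff_of_nonneg h0 (hg.integrable hwt hf.measurable)).1 h2
  have hΩ : ∀ᵐ ω ∂π, ω ∈ Omega n s₀ := by
    have h1 := hzero (fun ω => min 1 |ω 0 - s₀|) (by fun_prop) (fun ω => by positivity)
      (fun ω => min_le_left _ _) (fun ω hω => by simp [hω.1])
    have h2 : ∀ i : Fin (n + 1), ∀ᵐ ω ∂π, min 1 (max (-(ω i)) 0) = 0 := fun i =>
      hzero (fun ω => min 1 (max (-(ω i)) 0)) (by fun_prop)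
        (fun ω => le_min zero_le_one (le_max_right _ _))
        (fun ω => min_le_left _ _) (fun ω hω => by
          have := hω.2 i
          simp [this])
    filter_upwards [h1, ae_all_iff.2 h2] with ω h3 h4
    refine ⟨?_, fun i => ?_⟩
    · rcases min_choice (1 : ℝ) |ω 0 - s₀| with h | h
      · rw [h] at h3; norm_num at h3
      · rw [h] at h3
        linarith [abs_eq_zero.1 h3]
    · have h5 := h4 i
      rcases min_choice (1 : ℝ) (max (-(ω i)) 0) with h | h
      · rw [h] at h5; norm_num at h5
      · rw [h] at h5
        have := le_max_left (-(ω i)) 0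
        linarith
  have hIntg : ∀ i : Fin (n + 1), Integrable (fun ω : Path n => ω i) π := fun i =>
    (GG.coord i).integrable hwt (measurable_pi_apply i)
  refine ⟨⟨hprob, (mem_ae_iff_prob_eq_one (measurableSet_Omega n s₀)).1 hΩ, fun i => ?_⟩, ?_⟩
  · have hm : Measurable (fun ω : Path n => ω i.succ) := measurable_pi_apply _
    have : IsProbabilityMeasure (π.map (fun ω : Path n => ω i.succ)) :=
      Measure.isProbabilityMeasure_map hm.aemeasurable
    refine measure_eq_of_calls _ _ ?_ (hmom i) ?_ (hsupp i) (fun K hK => ?_)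
    · exact (integrable_map_measure measurable_id.aestronglyMeasurable hm.aemeasurable).2
        (hIntg i.succ)
    · rw [Measure.map_apply hm measurableSet_Iio]
      refine measure_mono_null (t := (Omega n s₀)ᶜ) (fun ω hω hω' => ?_) hΩ
      exact absurd (hω'.2 i.succ) (not_le.2 hω)
    · rw [integral_map hm.aemeasurable (by fun_prop : Measurable _).aestronglyMeasurable]
      have hg : GG (fun ω : Path n => max (ω i.succ - K) 0) :=
        ⟨|K| + 1, by positivity, fun ω => by
          refine (abs_call_le K (ω i.succ)).trans ?_
          have h1 := abs_le_wt ω i.succ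
          have h2 := wt_ge_one ω
          nlinarith [abs_nonneg K]⟩
      rw [hπ (fun ω : Path n => max (ω i.succ - K) 0) (by fun_prop) hg,
        L_static hL (stOne 1 i K hK) (hg.lin hs) (fun ω _ => by
          rw [callPayoff_eq, stOne_price, one_mul]), stOne_price, one_mul]
      rfl
  · intro j A hA
    refine superm_of_cont (Q := π) (T := restr j) (Y := fun ω => ω j.succ)
      (X := fun ω => ω j.castSucc) (measurable_restr j)
      (measurable_pi_apply _) (hIntg _)
      (by filter_upwards [hΩ] with ω h using h.2 _)
      (measurable_pi_apply _) (hIntg _)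
      (by filter_upwards [hΩ] with ω h using h.2 _) (fun g hg hg0 hg1 => ?_) A hA
    have hgb : ∀ a, |g a| ≤ 1 := fun a => by rw [abs_of_nonneg (hg0 a)]; exact hg1 a
    have hG : GG (fun ω : Path n => g (restr j ω) * (ω j.succ - ω j.castSucc)) := by
      refine GG.bmul (C := 1) (fun ω => hgb _) ?_
      have := (GG.coord j.succ).add (GG.coord j.castSucc).neg
      simpa only [← sub_eq_add_neg] using this
    rw [hπ (fun ω : Path n => g (restr j ω) * (ω j.succ - ω j.castSucc)) ((hg.comp (continuous_restr j)).mul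
      ((continuous_apply _).sub (continuous_apply _))) hG]
    refine (hL _ (hG.lin hs) 0 ⟨stConst n 0, dSingle j g hg.measurable 1 hgb,
      dSingle_nonneg _ _ _ _ _ hg0, by rw [stConst_price], fun ω _ => ?_⟩)
    rw [callPayoff_eq, stConst_price, dSingle_gains, zero_add]

end Mem


/-! ### The specific payoff -/

section Pay
variable {m : ℕ}

lemma pvec_eq (s₀ : ℝ) (s : Fin m → ℝ) : (fun j : Fin (m + 1) =>
      if h : (j : ℕ) = 0 then s₀ else s ⟨(j : ℕ) - 1, by have := j.isLt; omega⟩) =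
      (Fin.cons s₀ s : Fin (m + 1) → ℝ) := by
  funext j
  refine Fin.cases ?_ (fun i => ?_) j
  · simp
  · simp

lemma pmin_eq (s₀ : ℝ) (s : Fin m → ℝ) : pmin s₀ s =
    Finset.univ.inf' Finset.univ_nonempty (Fin.cons s₀ s : Fin (m + 1) → ℝ) := by
  unfold pmin
  rw [pvec_eq]

lemma pmax_eq (s₀ : ℝ) (s : Fin m → ℝ) : pmax s₀ s =
    Finset.univ.sup' Finset.univ_nonempty (Fin.cons s₀ s : Fin (m + 1) → ℝ) := by
  unfold pmax
  rw [pvec_eq]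

lemma pmin_le_iff (s₀ : ℝ) (s : Fin m → ℝ) (c : ℝ) :
    pmin s₀ s ≤ c ↔ s₀ ≤ c ∨ ∃ k, s k ≤ c := by
  rw [pmin_eq, Finset.inf'_le_iff]
  simp [Fin.exists_fin_succ]

lemma le_pmin_iff (s₀ : ℝ) (s : Fin m → ℝ) (c : ℝ) :
    c ≤ pmin s₀ s ↔ c ≤ s₀ ∧ ∀ k, c ≤ s k := by
  rw [pmin_eq, Finset.le_inf'_iff]
  simp [Fin.forall_fin_succ]

lemma le_pmax_iff (s₀ : ℝ) (s : Fin m → ℝ) (c : ℝ) :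
    c ≤ pmax s₀ s ↔ c ≤ s₀ ∨ ∃ k, c ≤ s k := by
  rw [pmax_eq, Finset.le_sup'_iff]
  simp [Fin.exists_fin_succ]

lemma pmax_le_iff (s₀ : ℝ) (s : Fin m → ℝ) (c : ℝ) :
    pmax s₀ s ≤ c ↔ s₀ ≤ c ∧ ∀ k, s k ≤ c := by
  rw [pmax_eq, Finset.sup'_le_iff]
  simp [Fin.forall_fin_succ]

lemma knock_iff (s₀ : ℝ) (s : Fin m → ℝ) (B : ℝ≥0∞) :
    ENNReal.ofReal (pmin s₀ s) ≤ B ↔ ENNReal.ofReal s₀ ≤ B ∨ ∃ k, ENNReal.ofReal (s k) ≤ B := by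
  constructor
  · intro h
    rcases (pmin_le_iff s₀ s (pmin s₀ s)).1 le_rfl with h1 | ⟨k, h1⟩
    · exact Or.inl ((ENNReal.ofReal_le_ofReal h1).trans h)
    · exact Or.inr ⟨k, (ENNReal.ofReal_le_ofReal h1).trans h⟩
  · rintro (h | ⟨k, h⟩)
    · exact (ENNReal.ofReal_le_ofReal ((pmin_le_iff s₀ s _).2 (Or.inl le_rfl))).trans h
    · exact (ENNReal.ofReal_le_ofReal ((pmin_le_iff s₀ s _).2 (Or.inr ⟨k, le_rfl⟩))).trans h

lemma continuous_pvec (s₀ : ℝ) (j : Fin (m + 1)) :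
    Continuous (fun s : Fin m → ℝ => (Fin.cons s₀ s : Fin (m + 1) → ℝ) j) := by
  refine Fin.cases ?_ (fun i => ?_) j
  · simp only [Fin.cons_zero]; exact continuous_const
  · simp only [Fin.cons_succ]; exact continuous_apply i

lemma continuous_pmin (s₀ : ℝ) : Continuous (fun s : Fin m → ℝ => pmin s₀ s) := by
  simp only [pmin_eq]
  exact Continuous.finset_inf'_apply _ (fun j _ => continuous_pvec s₀ j)

lemma continuous_pmax (s₀ : ℝ) : Continuous (fun s : Fin m → ℝ => pmax s₀ s) := by
  simp only [pmax_eq]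
  exact Continuous.finset_sup'_apply _ (fun j _ => continuous_pvec s₀ j)

end Pay

/-- The knock-in indicator. -/
def ind (B : ℝ≥0∞) (x : ℝ) : ℝ := if ENNReal.ofReal x ≤ B then 1 else 0

lemma ind_nonneg (B : ℝ≥0∞) (x : ℝ) : 0 ≤ ind B x := by unfold ind; split_ifs <;> norm_num

lemma ind_le_one (B : ℝ≥0∞) (x : ℝ) : ind B x ≤ 1 := by unfold ind; split_ifs <;> norm_num

lemma isClosed_knock (B : ℝ≥0∞) : IsClosed {x : ℝ | ENNReal.ofReal x ≤ B} :=
  isClosed_le ENNReal.continuous_ofReal continuous_const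

lemma ind_meas (B : ℝ≥0∞) : Measurable (ind B) := by
  unfold ind
  exact Measurable.ite (isClosed_knock B).measurableSet measurable_const measurable_const

/-- The dynamic strategy `β`, with a general function in place of the indicator. -/
def betaDyn (n : ℕ) (s₀ : ℝ) (φ : ℝ → ℝ) (hφ : Measurable φ) (h0 : ∀ x, 0 ≤ φ x)
    (h1 : ∀ x, φ x ≤ 1) : Dyn n where
  pos := fun j s => ((n : ℝ) - 1 - (j : ℕ)) + φ (pmin s₀ s)
  meas := fun j => measurable_const.add (hφ.comp (continuous_pmin s₀).measurable)
  bdd := fun j => ⟨n + 1, fun x => by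
    have hj : ((j : ℕ) : ℝ) + 1 ≤ n := by exact_mod_cast j.isLt
    have hj0 : (0 : ℝ) ≤ (j : ℕ) := Nat.cast_nonneg _
    have := h0 (pmin s₀ x)
    have := h1 (pmin s₀ x)
    rw [abs_of_nonneg (by linarith)]
    linarith⟩

lemma betaDyn_bound {n : ℕ} {s₀ : ℝ} {φ : ℝ → ℝ} (hφ : Measurable φ) (h0 : ∀ x, 0 ≤ φ x)
    (h1 : ∀ x, φ x ≤ 1) (j : Fin n) (x : Fin j → ℝ) :
    |(betaDyn n s₀ φ hφ h0 h1).pos j x| ≤ n + 1 := by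
  have hj : ((j : ℕ) : ℝ) + 1 ≤ n := by exact_mod_cast j.isLt
  have hj0 : (0 : ℝ) ≤ (j : ℕ) := Nat.cast_nonneg _
  have := h0 (pmin s₀ x)
  have := h1 (pmin s₀ x)
  change |((n : ℝ) - 1 - (j : ℕ)) + φ (pmin s₀ x)| ≤ _
  rw [abs_of_nonneg (by linarith)]
  linarith

lemma betaDyn_nonneg {n : ℕ} {s₀ : ℝ} {φ : ℝ → ℝ} (hφ : Measurable φ) (h0 : ∀ x, 0 ≤ φ x)
    (h1 : ∀ x, φ x ≤ 1) : (betaDyn n s₀ φ hφ h0 h1).Nonneg := by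
  intro j x
  have hj : ((j : ℕ) : ℝ) + 1 ≤ n := by exact_mod_cast j.isLt
  have := h0 (pmin s₀ x)
  change 0 ≤ ((n : ℝ) - 1 - (j : ℕ)) + φ (pmin s₀ x)
  linarith

/-- The compensated payoff `G - β·S`. -/
def HH {n : ℕ} (s₀ K : ℝ) (φ : ℝ → ℝ) (hφ : Measurable φ) (h0 : ∀ x, 0 ≤ φ x)
    (h1 : ∀ x, φ x ≤ 1) (ω : Path n) : ℝ :=
  φ (pmin s₀ (tailCoords ω)) * max (pmax s₀ (tailCoords ω) - K) 0 -
    (betaDyn n s₀ φ hφ h0 h1).gains ω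

lemma continuous_tail {n : ℕ} : Continuous (tailCoords : Path n → _) :=
  continuous_pi (fun i => continuous_apply i.succ)

section HHsec
variable {n : ℕ} {s₀ K : ℝ}

lemma HH_bound (hs : 0 < s₀) {φ : ℝ → ℝ} (hφ : Measurable φ) (h0 : ∀ x, 0 ≤ φ x)
    (h1 : ∀ x, φ x ≤ 1) (ω : Path n) :
    |HH s₀ K φ hφ h0 h1 ω| ≤ (s₀ + |K| + 1 + n * ((n + 1) * 2)) * wt ω := by
  have hw := wt_ge_one ω
  have a1 : |φ (pmin s₀ (tailCoords ω)) * max (pmax s₀ (tailCoords ω) - K) 0| ≤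
      (s₀ + |K| + 1) * wt ω := by
    have hm : max (pmax s₀ (tailCoords ω) - K) 0 ≤ (s₀ + |K| + 1) * wt ω := by
      have : pmax s₀ (tailCoords ω) ≤ s₀ + wt ω := by
        refine (pmax_le_iff _ _ _).2 ⟨by linarith, fun k => ?_⟩
        have := abs_le_wt ω k.succ
        have := le_abs_self (ω k.succ)
        change ω k.succ ≤ _
        linarith
      refine max_le ?_ (by positivity)
      have := neg_abs_le K
      have := abs_nonneg K
      nlinarith
    rw [abs_mul, abs_of_nonneg (h0 _), abs_of_nonneg (le_max_right _ _)]
    calc _ ≤ 1 * max (pmax s₀ (tailCoords ω) - K) 0 :=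
          mul_le_mul_of_nonneg_right (h1 _) (le_max_right _ _)
      _ ≤ _ := by rw [one_mul]; exact hm
  have a2 : |(betaDyn n s₀ φ hφ h0 h1).gains ω| ≤ n * ((n + 1) * 2) * wt ω := by
    unfold Dyn.gains
    refine (Finset.abs_sum_le_sum_abs _ _).trans ?_
    have : ∀ j ∈ (Finset.univ : Finset (Fin n)),
        |(betaDyn n s₀ φ hφ h0 h1).pos j (restr j ω) * (ω j.succ - ω j.castSucc)| ≤
        ((n : ℝ) + 1) * 2 * wt ω := by
      intro j _
      rw [abs_mul, mul_assoc]
      refine mul_le_mul (betaDyn_bound _ _ _ _ _) ?_ (abs_nonneg _) (by positivity)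
      refine (abs_sub _ _).trans ?_
      linarith [abs_le_wt ω j.succ, abs_le_wt ω j.castSucc]
    refine (Finset.sum_le_sum this).trans ?_
    simp only [Finset.sum_const, Finset.card_univ, Fintype.card_fin, nsmul_eq_mul]
    linarith
  unfold HH
  refine (abs_sub _ _).trans ?_
  linarith

lemma HH_GG (hs : 0 < s₀) {φ : ℝ → ℝ} (hφ : Measurable φ) (h0 : ∀ x, 0 ≤ φ x)
    (h1 : ∀ x, φ x ≤ 1) : GG (HH (n := n) s₀ K φ hφ h0 h1) :=
  ⟨_, by positivity, HH_bound hs hφ h0 h1⟩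

lemma measurable_gains (D : Dyn n) : Measurable (fun ω => D.gains ω) := by
  unfold Dyn.gains
  refine Finset.measurable_fun_sum _ (fun j _ => ?_)
  exact ((D.meas j).comp (measurable_restr j)).mul
    ((measurable_pi_apply _).sub (measurable_pi_apply _))

lemma HH_meas {φ : ℝ → ℝ} (hφ : Measurable φ) (h0 : ∀ x, 0 ≤ φ x)
    (h1 : ∀ x, φ x ≤ 1) : Measurable (HH (n := n) s₀ K φ hφ h0 h1) := by
  refine Measurable.sub ?_ (measurable_gains _)
  refine (hφ.comp ((continuous_pmin s₀).comp continuous_tail).measurable).mul ?_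
  exact (((continuous_pmax s₀).comp continuous_tail).measurable.sub measurable_const).max
    measurable_const

lemma HH_cont {φ : ℝ → ℝ} (hc : Continuous φ) (h0 : ∀ x, 0 ≤ φ x)
    (h1 : ∀ x, φ x ≤ 1) : Continuous (HH (n := n) s₀ K φ hc.measurable h0 h1) := by
  refine Continuous.sub ?_ ?_
  · refine (hc.comp ((continuous_pmin s₀).comp continuous_tail)).mul ?_
    exact (((continuous_pmax s₀).comp continuous_tail).sub continuous_const).max
      continuous_const
  · unfold Dyn.gains
    refine continuous_finsetSum _ (fun j _ => ?_)
    refine Continuous.mul ?_ ((continuous_apply _).sub (continuous_apply _))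
    exact continuous_const.add (hc.comp ((continuous_pmin s₀).comp (continuous_restr j)))

/-- Continuity in `φ`. -/
lemma HH_tendsto {φ : ℕ → ℝ → ℝ} (hφ : ∀ k, Measurable (φ k)) (h0 : ∀ k x, 0 ≤ φ k x)
    (h1 : ∀ k x, φ k x ≤ 1) {ψ : ℝ → ℝ} (hψ : Measurable ψ) (h0' : ∀ x, 0 ≤ ψ x)
    (h1' : ∀ x, ψ x ≤ 1) (ht : ∀ x, Tendsto (fun k => φ k x) atTop (𝓝 (ψ x))) (ω : Path n) :
    Tendsto (fun k => HH s₀ K (φ k) (hφ k) (h0 k) (h1 k) ω) atTop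
      (𝓝 (HH s₀ K ψ hψ h0' h1' ω)) := by
  refine Tendsto.sub ((ht _).mul_const _) ?_
  unfold Dyn.gains
  refine tendsto_finsetSum _ (fun j _ => Tendsto.mul_const _ ?_)
  exact Tendsto.const_add _ (ht _)

lemma HH_le {φ : ℝ → ℝ} (hφ : Measurable φ) (h0 : ∀ x, 0 ≤ φ x)
    (h1 : ∀ x, φ x ≤ 1) {ψ : ℝ → ℝ} (hψ : Measurable ψ) (h0' : ∀ x, 0 ≤ ψ x)
    (h1' : ∀ x, ψ x ≤ 1) (hle : ∀ x, ψ x ≤ φ x) :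
    ∃ D : Dyn n, D.Nonneg ∧ ∀ ω, HH s₀ K ψ hψ h0' h1' ω ≤ HH s₀ K φ hφ h0 h1 ω + D.gains ω := by
  refine ⟨dAdd (betaDyn n s₀ φ hφ h0 h1) (dSmul (-1) (betaDyn n s₀ ψ hψ h0' h1')), ?_, ?_⟩
  · intro j x
    change 0 ≤ (((n : ℝ) - 1 - (j : ℕ)) + φ (pmin s₀ x)) +
      (-1) * (((n : ℝ) - 1 - (j : ℕ)) + ψ (pmin s₀ x))
    linarith [hle (pmin s₀ x)]
  · intro ω
    rw [dAdd_gains, dSmul_gains]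
    unfold HH
    have := mul_le_mul_of_nonneg_right (hle (pmin s₀ (tailCoords ω)))
      (le_max_right (pmax s₀ (tailCoords ω) - K) 0)
    linarith

/-- Duality for the compensated payoff. -/
theorem duality_upper {μ : Fin n → Measure ℝ} [∀ i, IsProbabilityMeasure (μ i)] (hs : 0 < s₀)
    (hsupp : ∀ i, μ i (Set.Iio 0) = 0)
    (hmom : ∀ i, Integrable (fun x => x) (μ i)) (hne : (MSet s₀ μ).Nonempty) (B : ℝ≥0∞)
    {v : ℝ} (hv : ∀ q ∈ costs s₀ μ (HH s₀ K (ind B) (ind_meas B) (ind_nonneg B) (ind_le_one B)),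
      v ≤ q) :
    ∃ π ∈ MSet s₀ μ,
      v ≤ ∫ ω, HH s₀ K (ind B) (ind_meas B) (ind_nonneg B) (ind_le_one B) ω ∂π := by
  have hHg := HH_GG (n := n) (K := K) hs (ind_meas B) (ind_nonneg B) (ind_le_one B)
  obtain ⟨L, hLv, hL⟩ := exists_functional hmom hne (hHg.lin hs) hv
  obtain ⟨π, hfin, hwt, hπ⟩ := exists_measure hs hmom hL
  refine ⟨π, mem_MSet hs hsupp hmom hL hwt hπ, ?_⟩
  let th : ℕ → ℝ → ℝ := fun k x => ((thickenedIndicator (δ := 1 / ((k : ℝ) + 1)) (by positivity)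
    {x : ℝ | ENNReal.ofReal x ≤ B} x : ℝ≥0) : ℝ)
  have hc : ∀ k, Continuous (th k) := fun k => by
    change Continuous (fun x => ((thickenedIndicator (δ := 1 / ((k : ℝ) + 1)) (by positivity)
      {x : ℝ | ENNReal.ofReal x ≤ B} x : ℝ≥0) : ℝ))
    fun_prop
  have h0 : ∀ k x, 0 ≤ th k x := fun k x => NNReal.coe_nonneg _
  have h1 : ∀ k x, th k x ≤ 1 := fun k x => by
    exact_mod_cast thickenedIndicator_le_one _ _ x
  have hle : ∀ k x, ind B x ≤ th k x := fun k x => by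
    unfold ind
    split_ifs with h
    · have := thickenedIndicator_one (δ := 1 / ((k : ℝ) + 1)) (by positivity)
        {x : ℝ | ENNReal.ofReal x ≤ B} (x := x) h
      change (1 : ℝ) ≤ ((_ : ℝ≥0) : ℝ)
      rw [this]; simp
    · exact h0 k x
  have ht : ∀ x, Tendsto (fun k => th k x) atTop (𝓝 (ind B x)) := by
    intro x
    have h2 := thickenedIndicator_tendsto_indicator_closure
      (δseq := fun k : ℕ => 1 / ((k : ℝ) + 1)) (fun k => by positivity)
      (tendsto_one_div_add_atTop_nhds_zero_nat) {x : ℝ | ENNReal.ofReal x ≤ B}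
    rw [(isClosed_knock B).closure_eq] at h2
    have h3 := (NNReal.tendsto_coe.2 ((tendsto_pi_nhds.1 h2) x))
    convert h3 using 2
    unfold ind
    by_cases hx : ENNReal.ofReal x ≤ B
    · rw [if_pos hx, Set.indicator_of_mem (by exact hx)]; simp
    · rw [if_neg hx, Set.indicator_of_notMem (by exact hx)]; simp
  have hlim : Tendsto (fun k => ∫ ω, HH s₀ K (th k) (hc k).measurable (h0 k) (h1 k) ω ∂π) atTop
      (𝓝 (∫ ω, HH s₀ K (ind B) (ind_meas B) (ind_nonneg B) (ind_le_one B) ω ∂π)) := by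
    refine tendsto_integral_of_dominated_convergence
      (fun ω => (s₀ + |K| + 1 + n * ((n + 1) * 2)) * wt ω)
      (fun k => (HH_meas (hc k).measurable (h0 k) (h1 k)).aestronglyMeasurable)
      (hwt.const_mul _) (fun k => ae_of_all _ (fun ω => HH_bound hs _ _ _ ω))
      (ae_of_all _ (fun ω => HH_tendsto (fun k => (hc k).measurable) h0 h1 _ _ _ ht ω))
  refine ge_of_tendsto' hlim (fun k => ?_)
  rw [hπ _ (HH_cont (hc k) (h0 k) (h1 k)) (HH_GG hs _ _ _)]
  obtain ⟨D, hD, hDle⟩ := HH_le (n := n) (s₀ := s₀) (K := K) (hc k).measurable (h0 k) (h1 k)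
    (ind_meas B) (ind_nonneg B) (ind_le_one B) (hle k)
  exact hLv.trans (L_mono hL (hHg.lin hs) ((HH_GG hs _ _ _).lin hs) hD (fun ω _ => hDle ω))

end HHsec


/-! ### Truncation: from calls to puts -/

section Trunc
variable {n : ℕ} {s₀ : ℝ}

/-- The truncated path. -/
def tr {n : ℕ} (R : ℝ) (ω : Path n) : Path n := fun i => min (ω i) R

lemma tr_mem {R : ℝ} (hs : 0 < s₀) (hR : s₀ ≤ R) {ω : Path n} (hω : ω ∈ Omega n s₀) :
    tr R ω ∈ Omega n s₀ :=
  ⟨by simp only [tr]; rw [hω.1, min_eq_left hR], fun i => le_min (hω.2 i) (hs.le.trans hR)⟩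

lemma pmin_tr {m : ℕ} {R : ℝ} (hR : s₀ ≤ R) (s : Fin m → ℝ) :
    pmin s₀ (fun k => min (s k) R) = pmin s₀ s := by
  refine eq_of_forall_le_iff (fun c => ?_)
  rw [le_pmin_iff, le_pmin_iff]
  constructor
  · exact fun h => ⟨h.1, fun k => (h.2 k).trans (min_le_left _ _)⟩
  · exact fun h => ⟨h.1, fun k => le_min (h.2 k) (h.1.trans hR)⟩

/-- Knock-in before time `k`. -/
def Kn {n : ℕ} (B : ℝ≥0∞) (ω : Path n) (k : ℕ) : Prop :=
  ∃ i : Fin (n + 1), (i : ℕ) ≤ k ∧ ENNReal.ofReal (ω i) ≤ B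

lemma ind_restr {B : ℝ≥0∞} {ω : Path n} (hω : ω ∈ Omega n s₀) (j : Fin n) :
    ind B (pmin s₀ (restr j ω)) = if Kn B ω j then 1 else 0 := by
  unfold ind
  refine if_congr ?_ rfl rfl
  rw [knock_iff]
  constructor
  · rintro (h | ⟨k, h⟩)
    · exact ⟨0, by simp, by rw [hω.1]; exact h⟩
    · exact ⟨_, by have := k.isLt; simp only; omega, h⟩
  · rintro ⟨i, hi, h⟩
    by_cases h0 : i = 0
    · subst h0
      rw [hω.1] at h
      exact Or.inl h
    · have h1 : 0 < (i : ℕ) := Nat.pos_of_ne_zero (fun h => h0 (Fin.ext h))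
      refine Or.inr ⟨⟨(i : ℕ) - 1, by omega⟩, ?_⟩
      have : restr j ω ⟨(i : ℕ) - 1, by omega⟩ = ω i := by
        unfold restr
        congr 1
        exact Fin.ext (by simp only; omega)
      rw [this]
      exact h

lemma ind_tail {B : ℝ≥0∞} {ω : Path n} (hω : ω ∈ Omega n s₀) :
    ind B (pmin s₀ (tailCoords ω)) = if Kn B ω n then 1 else 0 := by
  unfold ind
  refine if_congr ?_ rfl rfl
  rw [knock_iff]
  constructor
  · rintro (h | ⟨k, h⟩)
    · exact ⟨0, by simp, by rw [hω.1]; exact h⟩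
    · exact ⟨k.succ, by have := k.isLt; simp only [Fin.val_succ]; omega, h⟩
  · rintro ⟨i, hi, h⟩
    by_cases h0 : i = 0
    · subst h0
      rw [hω.1] at h
      exact Or.inl h
    · obtain ⟨j, rfl⟩ := Fin.exists_succ_eq.2 h0
      exact Or.inr ⟨j, h⟩

lemma HH_trunc {K R : ℝ} {B : ℝ≥0∞} (hR : s₀ ≤ R) (hs : 0 < s₀) {ω : Path n}
    (hω : ω ∈ Omega n s₀) :
    HH s₀ K (ind B) (ind_meas B) (ind_nonneg B) (ind_le_one B) ω ≤
      HH s₀ K (ind B) (ind_meas B) (ind_nonneg B) (ind_le_one B) (tr R ω) := by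
  let E : ℕ → ℝ := fun k => if h : k < n + 1 then max (ω ⟨k, h⟩ - R) 0 else 0
  let J : ℕ → ℝ := fun k => if Kn B ω k then 1 else 0
  have hE0 : ∀ k, 0 ≤ E k := fun k => by
    simp only [E]; split_ifs
    · exact le_max_right _ _
    · exact le_rfl
  have hEi : ∀ i : Fin (n + 1), ω i - tr R ω i = E i := fun i => by
    simp only [E, i.isLt, dif_pos, tr, Fin.eta]
    rcases le_total (ω i) R with h | h
    · rw [min_eq_left h, max_eq_right (by linarith)]; ring
    · rw [min_eq_right h, max_eq_left (by linarith)]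
  have hEz : E 0 = 0 := by
    have := hEi 0
    rw [hω.1, (tr_mem hs hR hω).1] at this
    simpa using this.symm
  have c1 : ∀ N : ℕ, ∑ j ∈ Finset.range N, ((n : ℝ) - 1 - (j : ℕ)) * (E (j + 1) - E j) =
      ((n : ℝ) - N) * E N + ∑ j ∈ Finset.range N, E j := by
    intro N
    induction N with
    | zero => simp [hEz]
    | succ N ih =>
      rw [Finset.sum_range_succ, ih, Finset.sum_range_succ]
      push_cast
      ring
  have c2 : ∀ N : ℕ, N ≤ n → ∑ j ∈ Finset.range N, J j * (E (j + 1) - E j) = J N * E N := by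
    intro N
    induction N with
    | zero => intro _; simp [hEz]
    | succ N ih =>
      intro hN
      rw [Finset.sum_range_succ, ih (by omega)]
      have hk : J N * E (N + 1) = J (N + 1) * E (N + 1) := by
        simp only [J]
        by_cases h1 : Kn B ω N
        · have h2 : Kn B ω (N + 1) := by
            obtain ⟨i, hi, h⟩ := h1
            exact ⟨i, by omega, h⟩
          rw [if_pos h1, if_pos h2]
        · rw [if_neg h1]
          by_cases h2 : Kn B ω (N + 1)
          · have hz : E (N + 1) = 0 := by
              obtain ⟨i, hi, h⟩ := h2
              have hi2 : (i : ℕ) = N + 1 := by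
                by_contra hne
                exact h1 ⟨i, by omega, h⟩
              have h3 : ¬ ENNReal.ofReal s₀ ≤ B := fun h4 =>
                h1 ⟨0, by simp, by rw [hω.1]; exact h4⟩
              have h4 : ω i < s₀ := by
                by_contra h5
                exact h3 ((ENNReal.ofReal_le_ofReal (not_lt.1 h5)).trans h)
              have h5 := hEi i
              rw [hi2] at h5
              rw [← h5]
              simp only [tr]
              rw [min_eq_left (by linarith), sub_self]
            rw [hz]; simp
          · rw [if_neg h2]
      linarith
  have hg : (betaDyn n s₀ (ind B) (ind_meas B) (ind_nonneg B) (ind_le_one B)).gains ω -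
      (betaDyn n s₀ (ind B) (ind_meas B) (ind_nonneg B) (ind_le_one B)).gains (tr R ω) =
      ∑ j ∈ Finset.range n, E j + J n * E n := by
    have h1 : ∀ j : Fin n, (betaDyn n s₀ (ind B) (ind_meas B) (ind_nonneg B) (ind_le_one B)).pos j
        (restr j ω) * (ω j.succ - ω j.castSucc) -
        (betaDyn n s₀ (ind B) (ind_meas B) (ind_nonneg B) (ind_le_one B)).pos j
        (restr j (tr R ω)) * (tr R ω j.succ - tr R ω j.castSucc) =
        (fun j : ℕ => ((n : ℝ) - 1 - (j : ℕ)) * (E (j + 1) - E j) + J j * (E (j + 1) - E j)) j := by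
      intro j
      have e1 := hEi j.succ
      have e2 := hEi j.castSucc
      simp only [Fin.val_succ, Fin.val_castSucc] at e1 e2
      change (((n : ℝ) - 1 - (j : ℕ)) + ind B (pmin s₀ (restr j ω))) * _ -
        (((n : ℝ) - 1 - (j : ℕ)) + ind B (pmin s₀ (fun k => min (restr j ω k) R))) * _ = _
      beta_reduce
      rw [pmin_tr hR, ind_restr hω, ← e1, ← e2]
      simp only [J]
      ring
    unfold Dyn.gains
    rw [← Finset.sum_sub_distrib, Finset.sum_congr rfl (fun j _ => h1 j),
      Fin.sum_univ_eq_sum_range (fun j : ℕ => ((n : ℝ) - 1 - (j : ℕ)) * (E (j + 1) - E j) +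
        J j * (E (j + 1) - E j)) n, Finset.sum_add_distrib, c1, c2 n le_rfl]
    ring
  have hS0 : 0 ≤ ∑ j ∈ Finset.range n, E j := Finset.sum_nonneg (fun j _ => hE0 j)
  have hmx : max (pmax s₀ (tailCoords ω) - K) 0 ≤ max (pmax s₀ (tailCoords (tr R ω)) - K) 0 +
      (∑ j ∈ Finset.range n, E j + E n) := by
    have h2 : ∀ i : Fin (n + 1), E i ≤ ∑ j ∈ Finset.range n, E j + E n := fun i => by
      rw [← Finset.sum_range_succ]
      exact Finset.single_le_sum (fun j _ => hE0 j) (Finset.mem_range.2 i.isLt)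
    have h3 : pmax s₀ (tailCoords ω) ≤ pmax s₀ (tailCoords (tr R ω)) +
        (∑ j ∈ Finset.range n, E j + E n) := by
      have h4 := (pmax_le_iff s₀ (tailCoords (tr R ω)) _).1 le_rfl
      refine (pmax_le_iff _ _ _).2 ⟨by linarith [h4.1, hE0 n], fun k => ?_⟩
      have h5 := h4.2 k
      have h6 := hEi k.succ
      have h7 := h2 k.succ
      change ω k.succ ≤ _
      change tr R ω k.succ ≤ _ at h5
      linarith
    refine max_le ?_ ?_
    · linarith [le_max_left (pmax s₀ (tailCoords (tr R ω)) - K) 0]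
    · linarith [le_max_right (pmax s₀ (tailCoords (tr R ω)) - K) 0, hE0 n]
  unfold HH
  have h8 : pmin s₀ (tailCoords (tr R ω)) = pmin s₀ (tailCoords ω) := pmin_tr hR _
  rw [h8, ind_tail hω]
  have hJ : J n = if Kn B ω n then 1 else 0 := rfl
  rw [← hJ]
  have h9 : J n * max (pmax s₀ (tailCoords ω) - K) 0 ≤
      J n * max (pmax s₀ (tailCoords (tr R ω)) - K) 0 +
      (∑ j ∈ Finset.range n, E j + J n * E n) := by
    rw [hJ]
    split_ifs
    · linarith
    · linarith
  linarith

/-- The last coordinate `S_j` as a function of `(S₁,…,S_j)`. -/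
def lastv (s₀ : ℝ) {j : ℕ} (s : Fin j → ℝ) : ℝ := (Fin.cons s₀ s : Fin (j + 1) → ℝ) (Fin.last j)

lemma lastv_restr {ω : Path n} (hω : ω ∈ Omega n s₀) (j : Fin n) :
    lastv s₀ (restr j ω) = ω j.castSucc := by
  have : ∀ i : Fin ((j : ℕ) + 1), (Fin.cons s₀ (restr j ω) : Fin ((j : ℕ) + 1) → ℝ) i =
      ω ⟨(i : ℕ), by have := i.isLt; have := j.isLt; omega⟩ := by
    intro i
    refine Fin.cases ?_ (fun k => ?_) i
    · simp only [Fin.cons_zero]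
      exact hω.1.symm
    · simp only [Fin.cons_succ]
      rfl
  unfold lastv
  rw [this]
  rfl

/-- The truncated strategy. -/
def trDyn (s₀ R : ℝ) (D : Dyn n) : Dyn n where
  pos := fun j s => (if lastv s₀ s < R then 1 else 0) * D.pos j (fun k => min (s k) R)
  meas := fun j => by
    refine Measurable.mul ?_ ?_
    · exact Measurable.ite (measurableSet_lt (continuous_pvec s₀ _).measurable measurable_const)
        measurable_const measurable_const
    · exact (D.meas j).comp (measurable_pi_lambda _
        (fun k => (measurable_pi_apply k).min measurable_const))
  bdd := fun j => by
    obtain ⟨C, hC⟩ := D.bdd j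
    refine ⟨C, fun x => ?_⟩
    have h0 := (abs_nonneg _).trans (hC x)
    split_ifs
    · rw [one_mul]; exact hC _
    · rw [zero_mul, abs_zero]; exact h0

lemma trDyn_nonneg {R : ℝ} {D : Dyn n} (hD : D.Nonneg) : (trDyn s₀ R D).Nonneg := by
  intro j x
  refine mul_nonneg ?_ (hD _ _)
  split_ifs <;> norm_num

lemma trDyn_gains {R : ℝ} {D : Dyn n} (hD : D.Nonneg) {ω : Path n} (hω : ω ∈ Omega n s₀) :
    D.gains (tr R ω) ≤ (trDyn s₀ R D).gains ω := by
  unfold Dyn.gains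
  refine Finset.sum_le_sum (fun j _ => ?_)
  change D.pos j (fun k => min (restr j ω k) R) * (min (ω j.succ) R - min (ω j.castSucc) R) ≤
    ((if lastv s₀ (restr j ω) < R then 1 else 0) * D.pos j (fun k => min (restr j ω k) R)) * _
  rw [lastv_restr hω]
  have hp := hD j (fun k => min (restr j ω k) R)
  split_ifs with h
  · rw [one_mul]
    refine mul_le_mul_of_nonneg_left ?_ hp
    rw [min_eq_left h.le]
    linarith [min_le_left (ω j.succ) R]
  · rw [zero_mul, zero_mul]
    refine mul_nonpos_of_nonneg_of_nonpos hp ?_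
    rw [min_eq_right (not_lt.1 h)]
    linarith [min_le_right (ω j.succ) R]

/-- The put portfolio replicating truncated calls. -/
def putTr (R : ℝ) (hR : 0 ≤ R) (X : Static n) : Static n where
  const := X.const + ∑ k, X.coeff k * (R - X.strike k)
  m := X.m + X.m
  coeff := Fin.append X.coeff (fun k => - X.coeff k)
  idx := Fin.append X.idx X.idx
  strike := Fin.append X.strike (fun _ => R)
  strike_nonneg := by
    intro k
    refine Fin.addCases (fun i => ?_) (fun i => ?_) k
    · simpa using X.strike_nonneg i
    · rw [Fin.append_right]; exact hR

lemma putTr_price (R : ℝ) (hR : 0 ≤ R) (X : Static n) (u : Fin n → ℝ → ℝ) :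
    (putTr R hR X).price u = X.const +
      ∑ k, X.coeff k * (u (X.idx k) (X.strike k) - u (X.idx k) R + (R - X.strike k)) := by
  change X.const + ∑ k, X.coeff k * (R - X.strike k) + ∑ k : Fin (X.m + X.m),
    Fin.append X.coeff (fun k => - X.coeff k) k *
    u (Fin.append X.idx X.idx k) (Fin.append X.strike (fun _ => R) k) = _
  rw [Fin.sum_univ_add]
  simp only [Fin.append_left, Fin.append_right]
  rw [add_assoc, ← Finset.sum_add_distrib, ← Finset.sum_add_distrib]
  congr 1
  refine Finset.sum_congr rfl (fun k _ => ?_)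
  ring

lemma trunc_call {K R : ℝ} (h : K ≤ R) (x : ℝ) :
    max (K - x) 0 - max (R - x) 0 + (R - K) = max (min x R - K) 0 := by
  rcases le_total x R with h1 | h1
  · rw [min_eq_left h1, max_eq_left (by linarith : 0 ≤ R - x)]
    rcases le_total x K with h2 | h2
    · rw [max_eq_left (by linarith), max_eq_right (by linarith)]; ring
    · rw [max_eq_right (by linarith), max_eq_left (by linarith)]; ring
  · rw [min_eq_right h1, max_eq_right (by linarith), max_eq_right (by linarith),
      max_eq_left (by linarith)]; ring

lemma putTr_payoff {R : ℝ} (hR : 0 ≤ R) {X : Static n} (hX : ∀ k, X.strike k ≤ R) (ω : Path n) :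
    (putTr R hR X).putPayoff ω = X.callPayoff (tr R ω) := by
  rw [putPayoff_eq, putTr_price]
  unfold Static.callPayoff
  congr 1
  refine Finset.sum_congr rfl (fun k _ => ?_)
  rw [trunc_call (hX k)]
  rfl

lemma integrable_put (ν : Measure ℝ) [IsProbabilityMeasure ν]
    (hν : Integrable (fun x => x) ν) (K : ℝ) : Integrable (fun x => max (K - x) 0) ν :=
  integrable_opt (o := fun K x => max (K - x) 0) ν hν (fun K => by fun_prop) abs_put_le K

lemma trunc_price_tendsto (ν : Measure ℝ) [IsProbabilityMeasure ν]
    (hν : Integrable (fun x => x) ν) {K : ℝ} (hK : 0 ≤ K) :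
    Tendsto (fun R : ℕ => (∫ x, max (K - x) 0 ∂ν) - (∫ x, max ((R : ℝ) - x) 0 ∂ν) + ((R : ℝ) - K))
      atTop (𝓝 (∫ x, max (x - K) 0 ∂ν)) := by
  have h1 : Tendsto (fun R : ℕ => ∫ x, max (min x (R : ℝ) - K) 0 ∂ν) atTop
      (𝓝 (∫ x, max (x - K) 0 ∂ν)) := by
    refine tendsto_integral_of_dominated_convergence (fun x => |x|)
      (fun R => (by fun_prop : Measurable _).aestronglyMeasurable) hν.abs
      (fun R => ae_of_all _ (fun x => ?_)) (ae_of_all _ (fun x => ?_))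
    · rw [Real.norm_eq_abs, abs_of_nonneg (le_max_right _ _)]
      exact max_le (by linarith [min_le_left x (R : ℝ), le_abs_self x]) (abs_nonneg _)
    · refine tendsto_const_nhds.congr' ?_
      filter_upwards [(tendsto_natCast_atTop_atTop (R := ℝ)).eventually_ge_atTop x] with R hR
      rw [min_eq_left hR]
  refine h1.congr' ?_
  filter_upwards [(tendsto_natCast_atTop_atTop (R := ℝ)).eventually_ge_atTop K] with R hR
  have h2 : ∫ x, max (min x (R : ℝ) - K) 0 ∂ν =
      ∫ x, (max (K - x) 0 - max ((R : ℝ) - x) 0 + ((R : ℝ) - K)) ∂ν := by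
    simp only [trunc_call hR]
  have h3 := integral_add ((integrable_put ν hν K).sub (integrable_put ν hν R))
    (integrable_const ((R : ℝ) - K))
  have h4 := integral_sub (integrable_put ν hν K) (integrable_put ν hν R)
  simp only [Pi.sub_apply, integral_const, probReal_univ, one_smul] at h3 h4
  rw [h2, h3, h4]

lemma V_le_costs {K : ℝ} {μ : Fin n → Measure ℝ} [∀ i, IsProbabilityMeasure (μ i)] (hs : 0 < s₀)
    (hmom : ∀ i, Integrable (fun x => x) (μ i)) {B : ℝ≥0∞} {q : ℝ}
    (hq : q ∈ costs s₀ μ (HH s₀ K (ind B) (ind_meas B) (ind_nonneg B) (ind_le_one B))) :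
    V Static.putPayoff (fun i K' => ∫ x, max (K' - x) 0 ∂(μ i)) (Omega n s₀)
        (fun ω => ((lookbackPayoff s₀ K B (tailCoords ω) : ℝ) : EReal)) ≤ (q : EReal) := by
  obtain ⟨X, D, hD, rfl, h⟩ := hq
  have ht : Tendsto (fun R : ℕ => (putTr (R : ℝ) (Nat.cast_nonneg R) X).price
      (fun i K' => ∫ x, max (K' - x) 0 ∂(μ i))) atTop (𝓝 (X.price (cpr μ))) := by
    simp only [putTr_price]
    unfold Static.price
    refine Tendsto.const_add _ (tendsto_finsetSum _ (fun k _ => Tendsto.const_mul _ ?_))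
    exact trunc_price_tendsto (μ (X.idx k)) (hmom _) (X.strike_nonneg k)
  refine ge_of_tendsto ((continuous_coe_real_ereal.tendsto _).comp ht) ?_
  have e1 : ∀ᶠ R : ℕ in atTop, ∀ k, X.strike k ≤ (R : ℝ) := by
    rw [eventually_all]
    exact fun k => (tendsto_natCast_atTop_atTop (R := ℝ)).eventually_ge_atTop _
  filter_upwards [e1, (tendsto_natCast_atTop_atTop (R := ℝ)).eventually_ge_atTop s₀] with R hX hR
  refine sInf_le ⟨putTr (R : ℝ) (Nat.cast_nonneg R) X, dAdd (trDyn s₀ R D)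
    (betaDyn n s₀ (ind B) (ind_meas B) (ind_nonneg B) (ind_le_one B)),
    dAdd_nonneg (trDyn_nonneg hD) (betaDyn_nonneg _ _ _), rfl, fun ω hω => ?_⟩
  rw [EReal.coe_le_coe_iff, putTr_payoff _ hX, dAdd_gains]
  have h1 := h _ (tr_mem hs hR hω)
  have h2 := HH_trunc (K := K) (B := B) hR hs hω
  have h3 := trDyn_gains (R := R) hD hω
  have h4 : HH s₀ K (ind B) (ind_meas B) (ind_nonneg B) (ind_le_one B) ω =
    lookbackPayoff s₀ K B (tailCoords ω) -
    (betaDyn n s₀ (ind B) (ind_meas B) (ind_nonneg B) (ind_le_one B)).gains ω := rfl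
  linarith

end Trunc


/-! ### Weak duality -/

section Weak
variable {n : ℕ} {s₀ : ℝ}

lemma le_of_linear {a d C : ℝ} (h : ∀ x : ℝ, 0 ≤ x → a * x ≤ C + d * x) : a ≤ d := by
  by_contra hcon
  push Not at hcon
  have hpos : 0 < a - d := sub_pos.2 hcon
  have h1 := h ((|C| + 1) / (a - d)) (by positivity)
  have h2 : (a - d) * ((|C| + 1) / (a - d)) = |C| + 1 := by field_simp
  have := le_abs_self C
  nlinarith

/-- The path `(ω₀,…,ω_j,x,0,…,0)`. -/
def jump {n : ℕ} (j : Fin n) (ω : Path n) (x : ℝ) : Path n := fun k =>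
  if (k : ℕ) ≤ j then ω k else if (k : ℕ) = j + 1 then x else 0

lemma jump_mem {ω : Path n} (hω : ω ∈ Omega n s₀) (j : Fin n) {x : ℝ} (hx : 0 ≤ x) :
    jump j ω x ∈ Omega n s₀ := by
  refine ⟨?_, fun k => ?_⟩
  · simp only [jump, Fin.val_zero, Nat.zero_le, if_true]
    exact hω.1
  · simp only [jump]
    split_ifs
    · exact hω.2 k
    · exact hx
    · exact le_rfl

lemma restr_jump (ω : Path n) (j i : Fin n) (hij : (i : ℕ) ≤ j) (x : ℝ) :
    restr i (jump j ω x) = restr i ω := by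
  funext k
  simp only [restr, jump]
  rw [if_pos (by have := k.isLt; omega)]

lemma put_bounded (X : Static n) : ∃ C : ℝ, ∀ ω ∈ Omega n s₀, X.putPayoff ω ≤ C := by
  refine ⟨X.const + ∑ k, |X.coeff k| * X.strike k, fun ω hω => ?_⟩
  unfold Static.putPayoff
  refine add_le_add le_rfl (Finset.sum_le_sum (fun k _ => ?_))
  refine (le_abs_self _).trans ?_
  rw [abs_mul]
  refine mul_le_mul_of_nonneg_left ?_ (abs_nonneg _)
  rw [abs_of_nonneg (le_max_right _ _)]
  exact max_le (by linarith [hω.2 (X.idx k).succ]) (X.strike_nonneg k)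

lemma hedge_ge_beta {K : ℝ} {B : ℝ≥0∞} {X : Static n} {D : Dyn n}
    (h : ∀ ω ∈ Omega n s₀, lookbackPayoff s₀ K B (tailCoords ω) ≤ X.putPayoff ω + D.gains ω) :
    ∀ d : ℕ, ∀ j : Fin n, (j : ℕ) + 1 + d = n → ∀ ω ∈ Omega n s₀,
      ((n : ℝ) - 1 - (j : ℕ)) + ind B (pmin s₀ (restr j ω)) ≤ D.pos j (restr j ω) := by
  intro d
  induction d with
  | zero =>
    intro j hj ω hω
    obtain ⟨C, hC⟩ := put_bounded (s₀ := s₀) X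
    have hn1 : (n : ℝ) - 1 - (j : ℕ) = 0 := by
      have : ((j : ℕ) : ℝ) + 1 + 0 = n := by exact_mod_cast hj
      linarith
    rw [hn1, zero_add]
    set I := ind B (pmin s₀ (restr j ω)) with hI
    let A : Fin n → ℝ := fun i => if (i : ℕ) < j then D.pos i (restr i ω) *
      (ω i.succ - ω i.castSucc) else - (D.pos i (restr i ω) * ω i.castSucc)
    refine le_of_linear (C := I * K + C + ∑ i, A i) (fun x hx => ?_)
    have h1 := h _ (jump_mem hω j hx)
    have h2 := hC _ (jump_mem hω j hx)
    have h3 : (D.gains (jump j ω x)) ≤ ∑ i, A i + D.pos j (restr j ω) * x := by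
      have : ∀ i ∈ (Finset.univ : Finset (Fin n)),
          D.pos i (restr i (jump j ω x)) * (jump j ω x i.succ - jump j ω x i.castSucc) ≤
          A i + (if i = j then D.pos j (restr j ω) * x else 0) := by
        intro i _
        have hi : (i : ℕ) ≤ j := by have := i.isLt; omega
        rw [restr_jump ω j i hi]
        by_cases hij : i = j
        · subst hij
          simp only [A, jump, lt_irrefl, if_false, if_true, Fin.val_succ, Fin.val_castSucc,
            le_refl]
          rw [if_neg (by omega)]
          linarith
        · have hlt : (i : ℕ) < j := lt_of_le_of_ne hi (fun h => hij (Fin.ext h))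
          simp only [A, jump, hlt, hij, if_false, if_true, Fin.val_succ, Fin.val_castSucc, hi]
          rw [if_pos (by omega)]
          linarith
      refine (Finset.sum_le_sum this).trans_eq ?_
      rw [Finset.sum_add_distrib]
      simp
    have h4 : I * (x - K) ≤ lookbackPayoff s₀ K B (tailCoords (jump j ω x)) := by
      change I * (x - K) ≤ ind B (pmin s₀ (tailCoords (jump j ω x))) *
        max (pmax s₀ (tailCoords (jump j ω x)) - K) 0
      have hxm : x ≤ pmax s₀ (tailCoords (jump j ω x)) := by
        refine (le_pmax_iff _ _ _).2 (Or.inr ⟨j, ?_⟩)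
        simp [tailCoords, jump]
      have hI0 : 0 ≤ I := ind_nonneg _ _
      have hII : I ≤ ind B (pmin s₀ (tailCoords (jump j ω x))) := by
        rw [hI, ← restr_jump ω j j le_rfl x, ind_restr (jump_mem hω j hx),
          ind_tail (jump_mem hω j hx)]
        by_cases hk : Kn B (jump j ω x) j
        · have : Kn B (jump j ω x) n := by
            obtain ⟨i, hi, h⟩ := hk
            exact ⟨i, by omega, h⟩
          rw [if_pos hk, if_pos this]
        · rw [if_neg hk]
          split_ifs <;> norm_num
      calc I * (x - K) ≤ I * max (pmax s₀ (tailCoords (jump j ω x)) - K) 0 :=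
            mul_le_mul_of_nonneg_left
              ((by linarith : x - K ≤ pmax s₀ (tailCoords (jump j ω x)) - K).trans
                (le_max_left _ _)) hI0
        _ ≤ _ := mul_le_mul_of_nonneg_right hII (le_max_right _ _)
    linarith
  | succ d ih =>
    intro j hj ω hω
    obtain ⟨C, hC⟩ := put_bounded (s₀ := s₀) X
    have hjn : (j : ℕ) + 1 < n := by omega
    set I := ind B (pmin s₀ (restr j ω)) with hI
    let A : Fin n → ℝ := fun i => if (i : ℕ) < j then D.pos i (restr i ω) *
      (ω i.succ - ω i.castSucc) else if i = j then - (D.pos i (restr i ω) * ω i.castSucc) else 0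
    refine le_of_linear (C := K + C + ∑ i, A i) (fun x hx => ?_)
    have h1 := h _ (jump_mem hω j hx)
    have h2 := hC _ (jump_mem hω j hx)
    have hmem := jump_mem hω j hx
    have hb := ih ⟨(j : ℕ) + 1, hjn⟩ (by simp only; omega) _ hmem
    have hb2 : ((n : ℝ) - 2 - (j : ℕ)) + I ≤
        D.pos ⟨(j : ℕ) + 1, hjn⟩ (restr ⟨(j : ℕ) + 1, hjn⟩ (jump j ω x)) := by
      refine le_trans ?_ hb
      have hII : I ≤ ind B (pmin s₀ (restr ⟨(j : ℕ) + 1, hjn⟩ (jump j ω x))) := by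
        rw [hI, ← restr_jump ω j j le_rfl x, ind_restr hmem, ind_restr hmem]
        by_cases hk : Kn B (jump j ω x) j
        · have : Kn B (jump j ω x) (j + 1) := by
            obtain ⟨i, hi, h⟩ := hk
            exact ⟨i, by omega, h⟩
          rw [if_pos hk, if_pos this]
        · rw [if_neg hk]
          split_ifs <;> norm_num
      push_cast
      linarith
    have h3 : (D.gains (jump j ω x)) ≤ ∑ i, A i + D.pos j (restr j ω) * x +
        (-(((n : ℝ) - 2 - (j : ℕ)) + I) * x) := by
      have : ∀ i ∈ (Finset.univ : Finset (Fin n)),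
          D.pos i (restr i (jump j ω x)) * (jump j ω x i.succ - jump j ω x i.castSucc) ≤
          A i + (if i = j then D.pos j (restr j ω) * x else 0) +
          (if i = ⟨(j : ℕ) + 1, hjn⟩ then (-(((n : ℝ) - 2 - (j : ℕ)) + I) * x) else 0) := by
        intro i _
        rcases lt_trichotomy (i : ℕ) (j : ℕ) with hlt | heq | hgt
        · rw [restr_jump ω j i hlt.le]
          have hij : i ≠ j := fun h => by rw [h] at hlt; omega
          have hij1 : i ≠ ⟨(j : ℕ) + 1, hjn⟩ := fun h => by rw [h] at hlt; simp only at hlt; omega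
          simp only [A, jump, hlt, hij, hij1, if_false, if_true, Fin.val_succ, Fin.val_castSucc,
            hlt.le]
          rw [if_pos (by omega)]
          linarith
        · have hij : i = j := Fin.ext heq
          subst hij
          rw [restr_jump ω i i le_rfl]
          have hij1 : i ≠ ⟨(i : ℕ) + 1, hjn⟩ := fun h => by
            have := congrArg Fin.val h
            simp only at this
            omega
          simp only [A, jump, lt_irrefl, if_false, if_true, Fin.val_succ, Fin.val_castSucc,
            le_refl, hij1]
          rw [if_neg (by omega)]
          linarith
        · have hij : i ≠ j := fun h => by rw [h] at hgt; omega
          by_cases hij1 : i = ⟨(j : ℕ) + 1, hjn⟩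
          · subst hij1
            simp only [A, jump, hij, if_false, if_true, Fin.val_succ, Fin.val_castSucc]
            rw [if_neg (by omega), if_neg (by omega), if_neg (by omega), if_neg (by omega)]
            nlinarith
          · have hne : (i : ℕ) ≠ j + 1 := fun h => hij1 (Fin.ext h)
            simp only [A, jump, hij, hij1, if_false, Fin.val_succ, Fin.val_castSucc]
            rw [if_neg (by omega), if_neg (by omega), if_neg (by omega), if_neg (by omega),
              if_neg (by omega)]
            simp
      refine (Finset.sum_le_sum this).trans_eq ?_
      rw [Finset.sum_add_distrib, Finset.sum_add_distrib]
      simp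
    have h4 : x - K ≤ lookbackPayoff s₀ K B (tailCoords (jump j ω x)) := by
      change x - K ≤ ind B (pmin s₀ (tailCoords (jump j ω x))) *
        max (pmax s₀ (tailCoords (jump j ω x)) - K) 0
      have hxm : x ≤ pmax s₀ (tailCoords (jump j ω x)) := by
        refine (le_pmax_iff _ _ _).2 (Or.inr ⟨j, ?_⟩)
        simp [tailCoords, jump]
      have hk : Kn B (jump j ω x) n := by
        refine ⟨⟨(j : ℕ) + 2, by omega⟩, by simp only; omega, ?_⟩
        simp [jump]
      rw [ind_tail hmem, if_pos hk, one_mul]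
      exact (by linarith : x - K ≤ pmax s₀ (tailCoords (jump j ω x)) - K).trans (le_max_left _ _)
    have h5 : (((n : ℝ) - 1 - (j : ℕ)) + I) * x = x + (((n : ℝ) - 2 - (j : ℕ)) + I) * x := by ring
    linarith

lemma HH_integrable {μ : Fin n → Measure ℝ} {K : ℝ} {B : ℝ≥0∞} (hs : 0 < s₀)
    (hmom : ∀ i, Integrable (fun x => x) (μ i)) {Q : Measure (Path n)} (hQ : Q ∈ MSet s₀ μ) :
    Integrable (HH s₀ K (ind B) (ind_meas B) (ind_nonneg B) (ind_le_one B)) Q := by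
  have := hQ.1.1
  refine GG.integrable ?_ (HH_meas _ _ _) (HH_GG hs _ _ _)
  unfold wt
  exact (integrable_const _).add (integrable_finsetSum _
    (fun i _ => (integrable_coord hmom hQ i).abs))

lemma weak_duality {μ : Fin n → Measure ℝ} [∀ i, IsProbabilityMeasure (μ i)] {K : ℝ} {B : ℝ≥0∞}
    (hs : 0 < s₀) (hmom : ∀ i, Integrable (fun x => x) (μ i)) {Q : Measure (Path n)}
    (hQ : Q ∈ MSet s₀ μ) {X : Static n} {D : Dyn n}
    (h : ∀ ω ∈ Omega n s₀, lookbackPayoff s₀ K B (tailCoords ω) ≤ X.putPayoff ω + D.gains ω) :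
    ∫ ω, HH s₀ K (ind B) (ind_meas B) (ind_nonneg B) (ind_le_one B) ω ∂Q ≤
      X.price (fun i K' => ∫ x, max (K' - x) 0 ∂(μ i)) := by
  obtain ⟨h1, h2⟩ := static_price_integral hmom hQ (o := fun K x => max (K - x) 0)
    (fun K => by fun_prop) abs_put_le X
  let bD := betaDyn n s₀ (ind B) (ind_meas B) (ind_nonneg B) (ind_le_one B)
  let E : Dyn n := dAdd D (dSmul (-1) bD)
  have hE := gains_nonpos hmom hQ E (fun j ω hω => by
    have := hedge_ge_beta h (n - 1 - j) j (by have := j.isLt; omega) ω hω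
    change 0 ≤ D.pos j (restr j ω) + (-1) * (((n : ℝ) - 1 - (j : ℕ)) +
      ind B (pmin s₀ (restr j ω)))
    linarith)
  have h3 : ∫ ω, HH s₀ K (ind B) (ind_meas B) (ind_nonneg B) (ind_le_one B) ω ∂Q ≤
      ∫ ω, (X.price (fun i K => max (K - ω i.succ) 0) + E.gains ω) ∂Q := by
    refine integral_mono_ae (HH_integrable hs hmom hQ)
      (h1.add (gains_integrable hmom hQ E)) ?_
    filter_upwards [ae_Omega hQ] with ω hω
    have h4 := h ω hω
    rw [putPayoff_eq] at h4
    simp only [E]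
    rw [dAdd_gains, dSmul_gains]
    change lookbackPayoff s₀ K B (tailCoords ω) - bD.gains ω ≤ _
    linarith
  have h4 := integral_add h1 (gains_integrable hmom hQ E)
  linarith

lemma posE_coe (x : ℝ) : posE (x : EReal) = ENNReal.ofReal x := by
  unfold posE
  rw [if_neg (EReal.coe_ne_top x), EReal.toReal_coe]

lemma eexpE_coe {Q : Measure (Path n)} {f : Path n → ℝ} (hf : Integrable f Q) :
    eexpE Q (fun ω => (f ω : EReal)) = ((∫ ω, f ω ∂Q : ℝ) : EReal) := by
  unfold eexpE
  simp only [← EReal.coe_neg, posE_coe]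
  have h1 : ∫⁻ ω, ENNReal.ofReal (f ω) ∂Q ≠ ⊤ := hf.lintegral_lt_top.ne
  have h2 : ∫⁻ ω, ENNReal.ofReal (-f ω) ∂Q ≠ ⊤ := hf.neg.lintegral_lt_top.ne
  rw [integral_eq_lintegral_pos_part_sub_lintegral_neg_part hf, EReal.coe_sub,
    ← EReal.coe_ennreal_toReal h1, ← EReal.coe_ennreal_toReal h2]

theorem part_two {μ : Fin n → Measure ℝ} [∀ i, IsProbabilityMeasure (μ i)] {K : ℝ} {B : ℝ≥0∞}
    (hs : 0 < s₀) (hsupp : ∀ i, μ i (Set.Iio 0) = 0)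
    (hmom : ∀ i, Integrable (fun x => x) (μ i)) (hne : (MSet s₀ μ).Nonempty) :
    V Static.putPayoff (fun i K' => ∫ x, max (K' - x) 0 ∂(μ i)) (Omega n s₀)
        (fun ω => ((lookbackPayoff s₀ K B (tailCoords ω) : ℝ) : EReal)) =
      ⨆ Q ∈ MSet s₀ μ,
        eexpE Q (fun ω => ((lookbackPayoff s₀ K B (tailCoords ω) : ℝ) : EReal) -
          ((gainsOf (fun i s => ((n : ℝ) - 1 - (i : ℕ)) +
              (if ENNReal.ofReal (pmin s₀ s) ≤ B then 1 else 0)) ω : ℝ) : EReal)) := by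
  have hexp : ∀ Q ∈ MSet s₀ μ, eexpE Q
      (fun ω => ((lookbackPayoff s₀ K B (tailCoords ω) : ℝ) : EReal) -
          ((gainsOf (fun i s => ((n : ℝ) - 1 - (i : ℕ)) +
              (if ENNReal.ofReal (pmin s₀ s) ≤ B then 1 else 0)) ω : ℝ) : EReal)) =
      ((∫ ω, HH s₀ K (ind B) (ind_meas B) (ind_nonneg B) (ind_le_one B) ω ∂Q : ℝ) : EReal) := by
    intro Q hQ
    rw [← eexpE_coe (HH_integrable hs hmom hQ)]
    congr 1
  have hHg := HH_GG (n := n) (K := K) hs (ind_meas B) (ind_nonneg B) (ind_le_one B)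
  refine le_antisymm ?_ ?_
  · have hV : ∀ q ∈ costs s₀ μ (HH s₀ K (ind B) (ind_meas B) (ind_nonneg B) (ind_le_one B)), _ :=
      fun q hq => V_le_costs hs hmom hq
    generalize V Static.putPayoff (fun i K' => ∫ x, max (K' - x) 0 ∂(μ i)) (Omega n s₀)
        (fun ω => ((lookbackPayoff s₀ K B (tailCoords ω) : ℝ) : EReal)) = W at hV ⊢
    induction W with
    | bot => exact bot_le
    | top =>
      obtain ⟨q, hq⟩ := costs_nonempty (μ := μ) (hHg.lin hs)
      exact absurd (top_le_iff.1 (hV q hq)) (EReal.coe_ne_top q)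
    | coe r =>
      obtain ⟨π, hπ, hr⟩ := duality_upper hs hsupp hmom hne B
        (fun q hq => EReal.coe_le_coe_iff.1 (hV q hq))
      refine le_trans ?_ (le_iSup₂ π hπ)
      rw [hexp π hπ]
      exact EReal.coe_le_coe_iff.2 hr
  · refine iSup₂_le (fun Q hQ => ?_)
    rw [hexp Q hQ]
    refine le_sInf ?_
    rintro q ⟨X, D, -, rfl, h⟩
    exact EReal.coe_le_coe_iff.2 (weak_duality hs hmom hQ
      (fun ω hω => EReal.coe_le_coe_iff.1 (h ω hω)))

end Weak

section PartOne

variable {n : ℕ} {s₀ K : ℝ} {B : ℝ≥0∞}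

lemma exists_mkPath (i : Fin n) (s : Fin i → ℝ) (x : ℝ) (t : Fin (n - ((i : ℕ) + 1)) → ℝ)
    (p : ℝ → Prop) :
    (∃ k, p (tailCoords (mkPath s₀ i s x t) k)) ↔ (∃ k, p (s k)) ∨ p x ∨ ∃ k, p (t k) := by
  constructor
  · rintro ⟨k, hk⟩
    unfold tailCoords mkPath at hk
    split_ifs at hk with h0 h1 h2
    · simp at h0
    · exact Or.inl ⟨_, hk⟩
    · exact Or.inr (Or.inl hk)
    · exact Or.inr (Or.inr ⟨_, hk⟩)
  · rintro (⟨k, hk⟩ | hk | ⟨k, hk⟩)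
    · have h1 := k.isLt
      have h2 := i.isLt
      refine ⟨⟨k, by omega⟩, ?_⟩
      have : tailCoords (mkPath s₀ i s x t) ⟨k, by omega⟩ = s k := by
        unfold tailCoords mkPath
        rw [dif_neg (by simp), dif_pos (by simp only [Fin.val_succ]; omega)]
        congr 1
      rw [this]; exact hk
    · refine ⟨i, ?_⟩
      have : tailCoords (mkPath s₀ i s x t) i = x := by
        unfold tailCoords mkPath
        rw [dif_neg (by simp), dif_neg (by simp), dif_pos (by simp)]
      rw [this]; exact hk
    · have h1 := k.isLt
      have h2 := i.isLt
      refine ⟨⟨i + 1 + k, by omega⟩, ?_⟩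
      have : tailCoords (mkPath s₀ i s x t) ⟨i + 1 + k, by omega⟩ = t k := by
        unfold tailCoords mkPath
        rw [dif_neg (by simp), dif_neg (by simp only [Fin.val_succ]; omega),
          dif_neg (by simp only [Fin.val_succ]; omega)]
        congr 1
        apply Fin.ext
        simp only [Fin.val_succ]; omega
      rw [this]; exact hk

lemma forall_mkPath (i : Fin n) (s : Fin i → ℝ) (x : ℝ) (t : Fin (n - ((i : ℕ) + 1)) → ℝ)
    (p : ℝ → Prop) (hs : ∀ k, p (s k)) (hx : p x) (ht : ∀ k, p (t k)) (k : Fin n) :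
    p (tailCoords (mkPath s₀ i s x t) k) := by
  by_contra hk
  rcases (exists_mkPath i s x t (fun y => ¬ p y)).1 ⟨k, hk⟩ with ⟨j, h⟩ | h | ⟨j, h⟩
  · exact h (hs j)
  · exact h hx
  · exact h (ht j)

/-- Large values do not trigger the knock-in, unless the barrier is infinite. -/
lemma eventually_far (B : ℝ≥0∞) : ∀ᶠ x : ℝ in atTop, ENNReal.ofReal x ≤ B → B = ⊤ := by
  by_cases hB : B = ⊤
  · simp [hB]
  · filter_upwards [eventually_gt_atTop B.toReal] with x hx h
    exact absurd ((ENNReal.ofReal_le_iff_le_toReal hB).1 h) (not_le.2 hx)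

lemma eventually_ind_snoc {m : ℕ} (s₀ : ℝ) (B : ℝ≥0∞) (s : Fin m → ℝ) :
    ∀ᶠ x : ℝ in atTop, ind B (pmin s₀ (Fin.snoc s x : Fin (m + 1) → ℝ)) = ind B (pmin s₀ s) := by
  filter_upwards [eventually_far B] with x hx
  unfold ind
  refine if_congr ?_ rfl rfl
  rw [knock_iff, knock_iff]
  constructor
  · rintro (h | ⟨k, h⟩)
    · exact Or.inl h
    · induction k using Fin.lastCases with
      | last =>
        rw [Fin.snoc_last] at h
        left; rw [hx h]; exact le_top
      | cast k =>
        rw [Fin.snoc_castSucc] at h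
        exact Or.inr ⟨k, h⟩
  · rintro (h | ⟨k, h⟩)
    · exact Or.inl h
    · exact Or.inr ⟨k.castSucc, by rw [Fin.snoc_castSucc]; exact h⟩

/-- The knock-in indicator of the path without its large coordinate. -/
def indT (s₀ : ℝ) (B : ℝ≥0∞) {a b : ℕ} (s : Fin a → ℝ) (t : Fin b → ℝ) : ℝ :=
  if ENNReal.ofReal s₀ ≤ B ∨ (∃ k, ENNReal.ofReal (s k) ≤ B) ∨ (∃ k, ENNReal.ofReal (t k) ≤ B)
  then 1 else 0

lemma eventually_payoff (hs₀ : 0 < s₀) (i : Fin n) (s : Fin i → ℝ) (hs : ∀ k, 0 ≤ s k)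
    (t : Fin (n - ((i : ℕ) + 1)) → ℝ) (ht : ∀ k, 0 ≤ t k) :
    ∀ᶠ x : ℝ in atTop, mkPath s₀ i s x t ∈ Omega n s₀ ∧
      lookbackPayoff s₀ K B (tailCoords (mkPath s₀ i s x t)) * x⁻¹
        = indT s₀ B s t * (1 - K * x⁻¹) := by
  have e1 : ∀ᶠ x : ℝ in atTop, ∀ k, s k ≤ x :=
    eventually_all.2 fun k => eventually_ge_atTop (s k)
  have e2 : ∀ᶠ x : ℝ in atTop, ∀ k, t k ≤ x :=
    eventually_all.2 fun k => eventually_ge_atTop (t k)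
  filter_upwards [e1, e2, eventually_far B, eventually_ge_atTop s₀, eventually_ge_atTop K]
    with x h1 h2 h3 h4 h5
  have hx : 0 < x := hs₀.trans_le h4
  have hz : mkPath s₀ i s x t 0 = s₀ := by
    unfold mkPath; rw [dif_pos (by simp)]
  refine ⟨⟨hz, fun j => ?_⟩, ?_⟩
  · induction j using Fin.cases with
    | zero => rw [hz]; exact hs₀.le
    | succ k => exact forall_mkPath i s x t (fun y => 0 ≤ y) hs hx.le ht k
  · have hmax : pmax s₀ (tailCoords (mkPath s₀ i s x t)) = x := by
      apply le_antisymm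
      · exact (pmax_le_iff _ _ _).2 ⟨h4, forall_mkPath i s x t (fun y => y ≤ x) h1 le_rfl h2⟩
      · exact (le_pmax_iff _ _ _).2
          (Or.inr ((exists_mkPath i s x t (fun y => x ≤ y)).2 (Or.inr (Or.inl le_rfl))))
    have hind : (if ENNReal.ofReal (pmin s₀ (tailCoords (mkPath s₀ i s x t))) ≤ B
        then (1 : ℝ) else 0) = indT s₀ B s t := by
      unfold indT
      refine if_congr ?_ rfl rfl
      rw [knock_iff, exists_mkPath i s x t (fun y => ENNReal.ofReal y ≤ B)]
      constructor
      · rintro (h | h | h | h)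
        · exact Or.inl h
        · exact Or.inr (Or.inl h)
        · left; rw [h3 h]; exact le_top
        · exact Or.inr (Or.inr h)
      · rintro (h | h | h)
        · exact Or.inl h
        · exact Or.inr (Or.inl h)
        · exact Or.inr (Or.inr (Or.inr h))
    unfold lookbackPayoff
    rw [hind, hmax, max_eq_left (by linarith), mul_assoc, sub_mul, mul_inv_cancel₀ hx.ne']

lemma limsup_step (hs₀ : 0 < s₀) (i : Fin n) (s : Fin i → ℝ) (hs : ∀ k, 0 ≤ s k)
    (t : Fin (n - ((i : ℕ) + 1)) → ℝ) (ht : ∀ k, 0 ≤ t k) (f : ℝ → ℝ) (b : ℝ)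
    (hf : ∀ᶠ x in atTop, f x = b) :
    Filter.limsup (fun x : ℝ => if mkPath s₀ i s x t ∈ Omega n s₀ then
      ((f x : ℝ) : EReal) + ((lookbackPayoff s₀ K B (tailCoords (mkPath s₀ i s x t)) : ℝ) : EReal)
        * ((x⁻¹ : ℝ) : EReal) else 0) atTop = ((b + indT s₀ B s t : ℝ) : EReal) := by
  have h1 : Tendsto (fun x : ℝ => b + indT s₀ B s t * (1 - K * x⁻¹)) atTop
      (𝓝 (b + indT s₀ B s t * (1 - K * 0))) :=
    ((tendsto_const_nhds.sub (tendsto_inv_atTop_zero.const_mul K)).const_mul _).const_add b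
  have h2 : Tendsto (fun x : ℝ => ((b + indT s₀ B s t * (1 - K * x⁻¹) : ℝ) : EReal)) atTop
      (𝓝 ((b + indT s₀ B s t : ℝ) : EReal)) := by
    refine (continuous_coe_real_ereal.tendsto _).comp ?_
    simpa using h1
  refine Tendsto.limsup_eq (h2.congr' ?_)
  filter_upwards [hf, eventually_payoff (K := K) (B := B) hs₀ i s hs t ht] with x hx hp
  rw [if_pos hp.1, hx, ← EReal.coe_mul, ← EReal.coe_add, hp.2]

theorem part_one (hs₀ : 0 < s₀)
    (β : (i : Fin (n + 1)) → (Fin i → ℝ) → ℝ)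
    (hβ : IsBetaFamily s₀ (Omega n s₀) (fun s => ((lookbackPayoff s₀ K B s : ℝ) : EReal)) β) :
    ∀ (d : ℕ) (i : Fin n), (i : ℕ) + 1 + d = n → ∀ (s : Fin i → ℝ), (∀ k, 0 ≤ s k) →
      β ⟨(i : ℕ), by have := i.isLt; omega⟩ s =
        ((n : ℝ) - 1 - (i : ℕ)) + ind B (pmin s₀ s) := by
  intro d
  induction d with
  | zero =>
    intro i hi s hs
    have hb : ∀ u : Fin ((i : ℕ) + 1) → ℝ,
        β ⟨(i : ℕ) + 1, by have := i.isLt; omega⟩ u = 0 := by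
      have key : ∀ (j : Fin (n + 1)), j = Fin.last n → ∀ u : Fin j → ℝ, β j u = 0 := by
        rintro j rfl u; exact hβ.1 u
      exact key ⟨(i : ℕ) + 1, by omega⟩ (Fin.ext (by simp; omega))
    have h := hβ.2 i s hs
    have hI : ∀ t : Fin (n - ((i : ℕ) + 1)) → ℝ, indT s₀ B s t = ind B (pmin s₀ s) := by
      intro t
      unfold indT ind
      refine if_congr ?_ rfl rfl
      rw [knock_iff]
      constructor
      · rintro (h | h | ⟨k, h⟩)
        · exact Or.inl h
        · exact Or.inr h
        · have := k.isLt; omega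
      · rintro (h | h)
        · exact Or.inl h
        · exact Or.inr (Or.inl h)
    have hlim := fun t ht => limsup_step (K := K) (B := B) hs₀ i s hs t ht
      (fun x => β ⟨(i : ℕ) + 1, by have := i.isLt; omega⟩ (Fin.snoc s x)) 0
      (Eventually.of_forall fun x => hb _)
    have hsup : (⨆ (t : Fin (n - ((i : ℕ) + 1)) → ℝ) (_ : ∀ k, 0 ≤ t k),
        Filter.limsup (fun x : ℝ => if mkPath s₀ i s x t ∈ Omega n s₀ then
            ((β ⟨(i : ℕ) + 1, by have := i.isLt; omega⟩ (Fin.snoc s x) : ℝ) : EReal)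
              + ((lookbackPayoff s₀ K B (tailCoords (mkPath s₀ i s x t)) : ℝ) : EReal)
                * ((x⁻¹ : ℝ) : EReal)
          else 0) Filter.atTop) = ((ind B (pmin s₀ s) : ℝ) : EReal) := by
      apply le_antisymm
      · refine iSup₂_le fun t ht => ?_
        rw [hlim t ht, hI, zero_add]
      · refine le_trans ?_ (le_iSup₂ (fun _ => 0) (fun k => le_rfl))
        rw [hlim _ (fun k => le_rfl), hI, zero_add]
    rw [hsup, max_eq_right (by exact_mod_cast ind_nonneg B _)] at h
    have h' := EReal.coe_eq_coe_iff.1 h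
    rw [h']
    have : (n : ℝ) = (i : ℕ) + 1 := by exact_mod_cast hi.symm
    rw [this]; ring
  | succ d ih =>
    intro i hi s hs
    have h := hβ.2 i s hs
    have hb : ∀ᶠ x : ℝ in atTop, β ⟨(i : ℕ) + 1, by have := i.isLt; omega⟩ (Fin.snoc s x) =
        ((n : ℝ) - 2 - (i : ℕ)) + ind B (pmin s₀ s) := by
      filter_upwards [eventually_ind_snoc s₀ B s, eventually_ge_atTop 0] with x hx h0
      have := ih ⟨(i : ℕ) + 1, by omega⟩ (by simp only; omega) (Fin.snoc s x) (by
        intro k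
        change Fin ((i : ℕ) + 1) at k
        induction k using Fin.lastCases with
        | last => rw [Fin.snoc_last]; exact h0
        | cast k => rw [Fin.snoc_castSucc]; exact hs k)
      refine this.trans ?_
      rw [hx]; push_cast; ring
    have hlim := fun t ht => limsup_step (K := K) (B := B) hs₀ i s hs t ht
      (fun x => β ⟨(i : ℕ) + 1, by have := i.isLt; omega⟩ (Fin.snoc s x)) _ hb
    have hsup : (⨆ (t : Fin (n - ((i : ℕ) + 1)) → ℝ) (_ : ∀ k, 0 ≤ t k),
        Filter.limsup (fun x : ℝ => if mkPath s₀ i s x t ∈ Omega n s₀ then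
            ((β ⟨(i : ℕ) + 1, by have := i.isLt; omega⟩ (Fin.snoc s x) : ℝ) : EReal)
              + ((lookbackPayoff s₀ K B (tailCoords (mkPath s₀ i s x t)) : ℝ) : EReal)
                * ((x⁻¹ : ℝ) : EReal)
          else 0) Filter.atTop) =
          (((n : ℝ) - 1 - (i : ℕ) + ind B (pmin s₀ s) : ℝ) : EReal) := by
      apply le_antisymm
      · refine iSup₂_le fun t ht => ?_
        rw [hlim t ht, EReal.coe_le_coe_iff]
        have : indT s₀ B s t ≤ 1 := by unfold indT; split_ifs <;> norm_num
        linarith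
      · refine le_trans ?_ (le_iSup₂ (fun _ => 0) (fun k => le_rfl))
        rw [hlim _ (fun k => le_rfl), EReal.coe_le_coe_iff]
        have : indT s₀ B s (fun _ : Fin (n - ((i : ℕ) + 1)) => (0 : ℝ)) = 1 := by
          unfold indT
          rw [if_pos]
          exact Or.inr (Or.inr ⟨⟨0, by omega⟩, by simp⟩)
        linarith
    have hpos : (0 : ℝ) ≤ (n : ℝ) - 1 - (i : ℕ) + ind B (pmin s₀ s) := by
      have h1 : ((i : ℕ) : ℝ) + 1 ≤ n := by exact_mod_cast i.isLt
      linarith [ind_nonneg B (pmin s₀ s)]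
    rw [hsup, max_eq_right (by exact_mod_cast hpos)] at h
    exact EReal.coe_eq_coe_iff.1 h

end PartOne


/-- Lookback option with knock-in feature, Example 2: with
`𝔓 = Ω`, the recursively defined functions of the duality-gap theorem are
`β_i(s₁,…,s_i) = (n−1−i) + 1{min_{0≤j≤i} s_j ≤ B}`, and the put-based
superhedging price equals `sup_{ℙ ∈ M⁻_μ} E_ℙ[G − β₀(S₁−s₀) − Σ β_i(S₁,…,S_i)(S_{i+1}−S_i)]`. -/
theorem lookback_knockin_duality_gap
    {n : ℕ} (hn : 1 ≤ n) {s₀ : ℝ} (hs₀ : 0 < s₀) (K : ℝ) (hK : 0 ≤ K) (B : ℝ≥0∞)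
    (μ : Fin n → Measure ℝ) (hprob : ∀ i, IsProbabilityMeasure (μ i))
    (hsupp : ∀ i, μ i (Set.Iio 0) = 0) (hmom : ∀ i, Integrable (fun x => x) (μ i))
    (hA : AssumptionA s₀ μ) (hne : (MSet s₀ μ).Nonempty) :
    (∀ β : (i : Fin (n + 1)) → (Fin i → ℝ) → ℝ,
      IsBetaFamily s₀ (Omega n s₀)
        (fun s => ((lookbackPayoff s₀ K B s : ℝ) : EReal)) β →
      ∀ (i : Fin n) (s : Fin i → ℝ), (∀ k, 0 ≤ s k) →
        β ⟨(i : ℕ), by have := i.isLt; omega⟩ s =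
          ((n : ℝ) - 1 - (i : ℕ)) + (if ENNReal.ofReal (pmin s₀ s) ≤ B then 1 else 0)) ∧
    V Static.putPayoff (fun i K' => ∫ x, max (K' - x) 0 ∂(μ i)) (Omega n s₀)
        (fun ω => ((lookbackPayoff s₀ K B (tailCoords ω) : ℝ) : EReal)) =
      ⨆ Q ∈ MSet s₀ μ,
        eexpE Q (fun ω => ((lookbackPayoff s₀ K B (tailCoords ω) : ℝ) : EReal) -
          ((gainsOf (fun i s => ((n : ℝ) - 1 - (i : ℕ)) +
              (if ENNReal.ofReal (pmin s₀ s) ≤ B then 1 else 0)) ω : ℝ) : EReal)) := by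
  haveI := hprob
  refine ⟨fun β hβ i s hs => ?_, part_two hs₀ hsupp hmom hne⟩
  have hi := i.isLt
  exact part_one hs₀ β hβ (n - ((i : ℕ) + 1)) i (by omega) s hs

end RobustFin
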